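/- Let p be a prime, F a field of characteristic p, and A a central simple F-algebra with exp A = p. Let K/F be an inseparable field extension with [K:F] = p. Let n be a positive integer and assume λ_p(A_K) ≤ n. Then λ_p(A) ≤ n·p. -/

import Mathlib

open scoped TensorProduct

/-- A finite-dimensional central simple algebra over a field `F`. -/
def IsCSA (F A : Type) [Field F] [Ring A] [Algebra F A] : Prop :=
  Algebra.IsCentral F A ∧ IsSimpleRing A ∧ FiniteDimensional F A

/-- An `F`-algebra is split if it is isomorphic to a matrix algebra over `F`. -/
def IsSplitAlg (F A : Type) [Field F] [Ring A] [Algebra F A] : Prop :=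
  ∃ n : ℕ, 0 < n ∧ Nonempty (A ≃ₐ[F] Matrix (Fin n) (Fin n) F)

/-- Brauer equivalence of two algebras over a field `F`. -/
def IsBrauerEquiv (F A B : Type) [Field F] [Ring A] [Algebra F A] [Ring B] [Algebra F B] :
    Prop :=
  ∃ n m : ℕ, 0 < n ∧ 0 < m ∧
    Nonempty ((Matrix (Fin n) (Fin n) A) ≃ₐ[F] (Matrix (Fin m) (Fin m) B))

/-- `A` has exponent `e`: `e` is the least positive integer such that the `e`-fold tensor
power of `A` over `F` is split. -/
def HasExponent (F A : Type) [Field F] [Ring A] [Algebra F A] (e : ℕ) : Prop :=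
  0 < e ∧ IsSplitAlg F (⨂[F] _ : Fin e, A) ∧
    ∀ k : ℕ, 0 < k → IsSplitAlg F (⨂[F] _ : Fin k, A) → e ≤ k

/-- `A` has (Schur) index `d`: `A` is isomorphic to a matrix algebra over a division
algebra of dimension `d ^ 2` over `F`. -/
def HasIndex (F A : Type) [Field F] [Ring A] [Algebra F A] (d : ℕ) : Prop :=
  ∃ (D : Type) (_ : DivisionRing D) (_ : Algebra F D) (m : ℕ), 0 < m ∧
    Nonempty (A ≃ₐ[F] Matrix (Fin m) (Fin m) D) ∧ Module.finrank F D = d ^ 2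

/-- The (Schur) index of `A` is at most `d`. -/
def IndexLE (F A : Type) [Field F] [Ring A] [Algebra F A] (d : ℕ) : Prop :=
  ∃ e : ℕ, e ≤ d ∧ HasIndex F A e

/-- `A` is the cyclic (symbol) algebra `[a, b)_{p,F}` of degree `p` in characteristic `p`:
it has dimension `p ^ 2` over `F` and is generated by elements `i`, `j` subject to
`i ^ p - i = a`, `j ^ p = b`, `j * i = (i - 1) * j`. -/
def IsCyclicAlgWith (p : ℕ) (F A : Type) [Field F] [Ring A] [Algebra F A] (a b : F) : Prop :=
  b ≠ 0 ∧ Module.finrank F A = p ^ 2 ∧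
    ∃ i j : A, i ^ p - i = algebraMap F A a ∧ j ^ p = algebraMap F A b ∧
      j * i = (i - 1) * j ∧ Algebra.adjoin F {i, j} = ⊤

/-- `A` is a cyclic algebra of degree `p`, i.e. of the form `[a, b)_{p,F}`. -/
def IsCyclicPAlg (p : ℕ) (F A : Type) [Field F] [Ring A] [Algebra F A] : Prop :=
  ∃ a b : F, IsCyclicAlgWith p F A a b

/-- The `p`-symbol length of `A` is at most `m`: `A` is Brauer equivalent to a tensor
product of at most `m` cyclic `F`-algebras of degree `p`. -/
def SymbolLengthLE (p : ℕ) (F A : Type) [Field F] [Ring A] [Algebra F A] (m : ℕ) : Prop :=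
  ∃ k : ℕ, k ≤ m ∧ ∃ (D : Fin k → Type) (_ : ∀ i, Ring (D i)) (_ : ∀ i, Algebra F (D i)),
    (∀ i, IsCyclicPAlg p F (D i)) ∧ IsBrauerEquiv F A (⨂[F] i, D i)

/-- `M` is a compositum `LK` of `L` and `K` over `F`: it is generated as an `F`-algebra by
the images of `L` and `K`. -/
def IsCompositum (F L K M : Type) [Field F] [Field L] [Field K] [Field M]
    [Algebra F L] [Algebra F K] [Algebra F M] [Algebra L M] [Algebra K M]
    [IsScalarTower F L M] [IsScalarTower F K M] : Prop :=
  (IsScalarTower.toAlgHom F L M).range ⊔ (IsScalarTower.toAlgHom F K M).range = ⊤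

/-- A cyclic algebra of degree `m` over `F`: a central simple `F`-algebra of degree `m`
containing a cyclic field extension of `F` of degree `m` (as a maximal subfield). -/
def IsCyclicAlgebra (F A : Type) [Field F] [Ring A] [Algebra F A] (m : ℕ) : Prop :=
  IsCSA F A ∧ Module.finrank F A = m ^ 2 ∧
  ∃ (L : Type) (_ : Field L) (_ : Algebra F L), IsGalois F L ∧ IsCyclic (L ≃ₐ[F] L) ∧
    Module.finrank F L = m ∧ Nonempty (L →ₐ[F] A)

/-- `L/F` is a `p`-extension: there is a tower of intermediate fields from `F` to `L`
each step of which is a cyclic extension of degree `p`. -/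
def IsPExtension (p : ℕ) (F L : Type) [Field F] [Field L] [Algebra F L] : Prop :=
  ∃ (n : ℕ) (T : Fin (n + 1) → IntermediateField F L),
    T 0 = ⊥ ∧ T (Fin.last n) = ⊤ ∧
    ∀ i : Fin n, ∃ h : T i.castSucc ≤ T i.succ,
      IsGalois (T i.castSucc) (IntermediateField.extendScalars h) ∧
      IsCyclic ((IntermediateField.extendScalars h) ≃ₐ[T i.castSucc]
        (IntermediateField.extendScalars h)) ∧
      Module.finrank (T i.castSucc) (IntermediateField.extendScalars h) = p

/-- `F` is `p`-cyclic reducible: for every central simple `F`-algebra `A` of exponent `p`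
and every purely inseparable extension `K/F` with `K ^ p ⊆ F`, either `A_K` is split, or
there is a separable extension `L/F` of degree `ind (A_K) / p` such that `A_{LK}` is
Brauer equivalent to a cyclic `LK`-algebra of degree `p`. -/
def IsPCyclicReducible (p : ℕ) (F : Type) [Field F] : Prop :=
  ∀ (A : Type) [Ring A] [Algebra F A], IsCSA F A → HasExponent F A p →
  ∀ (K : Type) [Field K] [Algebra F K], IsPurelyInseparable F K →
    (∀ z : K, z ^ p ∈ (algebraMap F K).range) →
    IsSplitAlg K (K ⊗[F] A) ∨
    ∃ d : ℕ, HasIndex K (K ⊗[F] A) (p * d) ∧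
      ∃ (L : Type) (_ : Field L) (_ : Algebra F L), Algebra.IsSeparable F L ∧
        Module.finrank F L = d ∧
        ∃ (M : Type) (_ : Field M) (_ : Algebra F M) (_ : Algebra L M) (_ : Algebra K M)
          (_ : IsScalarTower F L M) (_ : IsScalarTower F K M),
          IsCompositum F L K M ∧
          ∃ (C : Type) (_ : Ring C) (_ : Algebra M C),
            IsCyclicPAlg p M C ∧ IsBrauerEquiv M (M ⊗[F] A) C

/-- `F` is `p`-reducible: for every central simple `F`-algebra `A` of exponent `p`
and every purely inseparable extension `K/F` with `K ^ p ⊆ F`, either `A_K` is split, or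
there is a separable extension `L/F` of degree `ind (A_K) / p` with `ind A_{LK} = p`. -/
def IsPReducible (p : ℕ) (F : Type) [Field F] : Prop :=
  ∀ (A : Type) [Ring A] [Algebra F A], IsCSA F A → HasExponent F A p →
  ∀ (K : Type) [Field K] [Algebra F K], IsPurelyInseparable F K →
    (∀ z : K, z ^ p ∈ (algebraMap F K).range) →
    IsSplitAlg K (K ⊗[F] A) ∨
    ∃ d : ℕ, HasIndex K (K ⊗[F] A) (p * d) ∧
      ∃ (L : Type) (_ : Field L) (_ : Algebra F L), Algebra.IsSeparable F L ∧
        Module.finrank F L = d ∧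
        ∃ (M : Type) (_ : Field M) (_ : Algebra F M) (_ : Algebra L M) (_ : Algebra K M)
          (_ : IsScalarTower F L M) (_ : IsScalarTower F K M),
          IsCompositum F L K M ∧ HasIndex M (M ⊗[F] A) p

namespace TensorProduct

/-- The tensor product of a simple algebra with a central simple algebra over a field is
simple. -/
theorem isSimpleRing_of_isCentral (F A B : Type*) [Field F] [Ring A] [Algebra F A] [Ring B]
    [Algebra F B] [IsSimpleRing A] [IsSimpleRing B] [Algebra.IsCentral F B] :
    IsSimpleRing (A ⊗[F] B) := by
  classical
  refine IsSimpleRing.of_eq_bot_or_eq_top fun I => or_iff_not_imp_left.mpr fun hI => ?_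
  let bA := Module.Basis.ofVectorSpace F A
  let e := TensorProduct.equivFinsuppOfBasisLeft (N := B) bA
  have he_left (b : B) (x : A ⊗[F] B) (i) : e (1 ⊗ₜ b * x) i = b * e x i := by
    induction x with
    | zero => simp
    | tmul a c => simp [e]
    | add x y hx hy => simp [mul_add, hx, hy]
  have he_right (b : B) (x : A ⊗[F] B) (i) : e (x * 1 ⊗ₜ b) i = e x i * b := by
    induction x with
    | zero => simp
    | tmul a c => simp [e]
    | add x y hx hy => simp [add_mul, hx, hy]
  obtain ⟨x₀, hx₀, hx₀ne⟩ : ∃ x ∈ I, x ≠ 0 := by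
    by_contra! h
    exact hI (le_bot_iff.mp fun x hx => (TwoSidedIdeal.mem_bot _).mpr (h x hx))
  obtain ⟨x, ⟨hxI, hx0⟩, hmin⟩ : ∃ x, (x ∈ I ∧ x ≠ 0) ∧ ∀ y, (y ∈ I ∧ y ≠ 0) →
      (e x).support.card ≤ (e y).support.card :=
    exists_minimalFor_of_wellFoundedLT (fun x => x ∈ I ∧ x ≠ 0)
      (fun x => (e x).support.card) ⟨x₀, hx₀, hx₀ne⟩ |>.imp fun x hx =>
        ⟨hx.1, fun y hy => (le_total _ _).elim id (fun h => hx.2 hy h)⟩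
  obtain ⟨i₀, hi₀⟩ : ∃ i, e x i ≠ 0 := by
    by_contra! h
    exact hx0 (e.injective (by ext i; simpa using h i))
  let J : TwoSidedIdeal B := TwoSidedIdeal.mk'
    {c | ∃ y ∈ I, (∀ i, e x i = 0 → e y i = 0) ∧ e y i₀ = c}
    ⟨0, I.zero_mem, by simp, by simp⟩
    (by
      rintro _ _ ⟨y, hy, hs, rfl⟩ ⟨z, hz, ht, rfl⟩
      exact ⟨y + z, I.add_mem hy hz, fun i hi => by simp [hs i hi, ht i hi], by simp⟩)
    (by
      rintro _ ⟨y, hy, hs, rfl⟩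
      exact ⟨-y, I.neg_mem hy, fun i hi => by simp [hs i hi], by simp⟩)
    (by
      rintro b _ ⟨y, hy, hs, rfl⟩
      exact ⟨1 ⊗ₜ b * y, I.mul_mem_left _ _ hy, fun i hi => by simp [he_left, hs i hi],
        he_left _ _ _⟩)
    (by
      rintro _ b ⟨y, hy, hs, rfl⟩
      exact ⟨y * 1 ⊗ₜ b, I.mul_mem_right _ _ hy, fun i hi => by simp [he_right, hs i hi],
        he_right _ _ _⟩)
  have hJ (c : B) : c ∈ J ↔ ∃ y ∈ I, (∀ i, e x i = 0 → e y i = 0) ∧ e y i₀ = c := by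
    simp [J, TwoSidedIdeal.mem_mk']
  obtain ⟨y, hyI, hys, hy1⟩ := (hJ 1).mp
    (IsSimpleRing.one_mem_of_ne_zero_mem J hi₀ ((hJ _).mpr ⟨x, hxI, fun i hi => hi, rfl⟩))
  have hcomm (b : B) : 1 ⊗ₜ b * y = y * 1 ⊗ₜ b := by
    by_contra hne
    have hz := hmin (1 ⊗ₜ b * y - y * 1 ⊗ₜ b)
      ⟨I.sub_mem (I.mul_mem_left _ _ hyI) (I.mul_mem_right _ _ hyI), sub_ne_zero.mpr hne⟩
    refine absurd hz (not_le.mpr (Finset.card_lt_card ?_))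
    refine Finset.ssubset_iff_of_subset ?_ |>.mpr ⟨i₀, by simpa using hi₀, ?_⟩
    · intro i hi
      simp only [Finsupp.mem_support_iff] at hi ⊢
      intro h
      exact hi (by simp [he_left, he_right, hys i h])
    · simp [he_left, he_right, hy1]
  have hyc (i) : ∃ c : F, e y i = algebraMap F B c := by
    apply (Algebra.IsCentral.mem_center_iff F).mp
    rw [Subalgebra.mem_center_iff]
    intro b
    rw [← he_left, ← he_right, hcomm]
  choose c hc using hyc
  obtain ⟨a, ha⟩ : ∃ a : A, y = a ⊗ₜ 1 := by
    refine ⟨bA.repr.symm (Finsupp.onFinset (e y).support c ?_), ?_⟩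
    · intro i hi
      simp only [Finsupp.mem_support_iff, hc]
      simpa using hi
    · apply e.injective
      ext i
      simp [e, hc, Algebra.algebraMap_eq_smul_one]
  have ha0 : a ≠ 0 := by
    rintro rfl
    simp [ha] at hy1
  let I' : TwoSidedIdeal A := I.comap (Algebra.TensorProduct.includeLeft : A →ₐ[F] A ⊗[F] B)
  have h1 : (1 : A) ∈ I' := IsSimpleRing.one_mem_of_ne_zero_mem I' ha0 (by
    simpa [I', TwoSidedIdeal.mem_comap, ← ha] using hyI)
  rw [TwoSidedIdeal.mem_comap, map_one] at h1
  exact eq_top_iff.mpr fun z _ => by simpa using I.mul_mem_left z 1 h1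

/-- An element of `A ⊗ B` commuting with `1 ⊗ B`, for `B` central, lies in `A ⊗ 1`. -/
theorem exists_tmul_one_of_commute (F A B : Type*) [Field F] [Ring A] [Algebra F A] [Ring B]
    [Algebra F B] [Algebra.IsCentral F B] (x : A ⊗[F] B)
    (hx : ∀ b : B, 1 ⊗ₜ b * x = x * 1 ⊗ₜ b) : ∃ a : A, x = a ⊗ₜ 1 := by
  have h : x ∈ Subalgebra.centralizer F
      (Algebra.TensorProduct.includeRight : B →ₐ[F] A ⊗[F] B).range := by
    rw [Subalgebra.mem_centralizer_iff]
    rintro _ ⟨b, rfl⟩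
    exact hx b
  rw [Subalgebra.centralizer_range_includeRight_eq_center_tensorProduct] at h
  clear hx
  obtain ⟨y, rfl⟩ := h
  induction y with
  | zero => exact ⟨0, by simp⟩
  | tmul a c =>
    obtain ⟨r, hr⟩ := (Algebra.IsCentral.mem_center_iff F).mp c.2
    refine ⟨r • a, ?_⟩
    simp [hr, Algebra.algebraMap_eq_smul_one, TensorProduct.smul_tmul]
  | add y z hy hz =>
    obtain ⟨a, ha⟩ := hy
    obtain ⟨a', ha'⟩ := hz
    exact ⟨a + a', by
      simp only [AlgHom.toRingHom_eq_coe, RingHom.coe_coe, map_add] at *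
      rw [ha, ha', TensorProduct.add_tmul]⟩

/-- The tensor product of central algebras over a field is central. -/
theorem isCentral (F A B : Type*) [Field F] [Ring A] [Algebra F A] [Ring B]
    [Algebra F B] [Algebra.IsCentral F A] [Algebra.IsCentral F B] [Nontrivial B] :
    Algebra.IsCentral F (A ⊗[F] B) where
  out x hx := by
    rw [Subalgebra.mem_center_iff] at hx
    obtain ⟨a, rfl⟩ := exists_tmul_one_of_commute F A B x fun b => hx _
    have ha : a ∈ Subalgebra.center F A := by
      rw [Subalgebra.mem_center_iff]
      intro a'
      have := hx (a' ⊗ₜ 1)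
      simp only [Algebra.TensorProduct.tmul_mul_tmul, mul_one] at this
      exact Algebra.TensorProduct.includeLeft_injective (S := F)
        (FaithfulSMul.algebraMap_injective F B) this
    obtain ⟨r, rfl⟩ := (Algebra.IsCentral.mem_center_iff F).mp ha
    exact ⟨r, by simp [Algebra.TensorProduct.algebraMap_apply]⟩

/-- The base change of a central algebra along a field extension is central. -/
theorem isCentral_baseChange (F L B : Type*) [Field F] [Field L] [Algebra F L] [Ring B]
    [Algebra F B] [Algebra.IsCentral F B] : Algebra.IsCentral L (L ⊗[F] B) where
  out x hx := by
    rw [Subalgebra.mem_center_iff] at hx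
    obtain ⟨a, rfl⟩ := exists_tmul_one_of_commute F L B x fun b => hx _
    exact ⟨a, by simp [Algebra.TensorProduct.algebraMap_apply]⟩

end TensorProduct

attribute [instance] TensorProduct.isSimpleRing_of_isCentral TensorProduct.isCentral
  TensorProduct.isCentral_baseChange

namespace IsBrauerEquiv

variable {F A B C : Type} [Field F] [Ring A] [Algebra F A] [Ring B] [Algebra F B]
  [Ring C] [Algebra F C]

theorem of_matrix {ι κ : Type*} [Fintype ι] [DecidableEq ι] [Nonempty ι] [Fintype κ]
    [DecidableEq κ] [Nonempty κ] (e : Matrix ι ι A ≃ₐ[F] Matrix κ κ B) :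
    IsBrauerEquiv F A B :=
  ⟨Fintype.card ι, Fintype.card κ, Fintype.card_pos, Fintype.card_pos,
    ⟨(Matrix.reindexAlgEquiv F A (Fintype.equivFin ι)).symm.trans
      (e.trans (Matrix.reindexAlgEquiv F B (Fintype.equivFin κ)))⟩⟩

theorem of_algEquiv (e : A ≃ₐ[F] B) : IsBrauerEquiv F A B :=
  ⟨1, 1, one_pos, one_pos, ⟨e.mapMatrix⟩⟩

theorem of_algEquiv_matrix {ι : Type*} [Fintype ι] [DecidableEq ι] [Nonempty ι]
    (e : A ≃ₐ[F] Matrix ι ι B) : IsBrauerEquiv F A B :=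
  of_matrix (ι := PUnit.{1}) ((Matrix.uniqueAlgEquiv (m := PUnit.{1}) (R := F) (A := A)).trans e)

theorem tensor {D : Type} [Ring D] [Algebra F D] (h : IsBrauerEquiv F A B)
    (h' : IsBrauerEquiv F C D) : IsBrauerEquiv F (A ⊗[F] C) (B ⊗[F] D) := by
  obtain ⟨n, m, hn, hm, ⟨e⟩⟩ := h
  obtain ⟨k, l, hk, hl, ⟨f⟩⟩ := h'
  have : NeZero n := ⟨hn.ne'⟩
  have : NeZero m := ⟨hm.ne'⟩
  have : NeZero k := ⟨hk.ne'⟩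
  have : NeZero l := ⟨hl.ne'⟩
  exact of_matrix ((Matrix.kroneckerTMulAlgEquiv (Fin n) (Fin k) F F A C).symm.trans
    ((Algebra.TensorProduct.congr e f).trans
      (Matrix.kroneckerTMulAlgEquiv (Fin m) (Fin l) F F B D)))

end IsBrauerEquiv

section Brauer

variable (F : Type) [Field F]

/-- The class of a central simple algebra in the Brauer group. -/
noncomputable def brauerClass (A : Type) [Ring A] [Algebra F A] [Algebra.IsCentral F A]
    [IsSimpleRing A] [FiniteDimensional F A] : BrauerGroup.{0, 0} F :=
  Quotient.mk _ { AlgCat.of F A with }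

variable {F}

theorem brauerClass_eq_iff {A B : Type} [Ring A] [Algebra F A] [Algebra.IsCentral F A]
    [IsSimpleRing A] [FiniteDimensional F A] [Ring B] [Algebra F B] [Algebra.IsCentral F B]
    [IsSimpleRing B] [FiniteDimensional F B] :
    brauerClass F A = brauerClass F B ↔ IsBrauerEquiv F A B := by
  rw [brauerClass, brauerClass, Quotient.eq]
  simp only [IsBrauerEquiv, Nat.pos_iff_ne_zero]
  rfl

theorem brauerClass_congr {A B : Type} [Ring A] [Algebra F A] [Algebra.IsCentral F A]
    [IsSimpleRing A] [FiniteDimensional F A] [Ring B] [Algebra F B] [Algebra.IsCentral F B]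
    [IsSimpleRing B] [FiniteDimensional F B] (e : A ≃ₐ[F] B) :
    brauerClass F A = brauerClass F B :=
  brauerClass_eq_iff.mpr (.of_algEquiv e)

theorem BrauerGroup.ind_on {P : BrauerGroup.{0, 0} F → Prop} (x : BrauerGroup.{0, 0} F)
    (h : ∀ (A : Type) [Ring A] [Algebra F A] [Algebra.IsCentral F A] [IsSimpleRing A]
      [FiniteDimensional F A], P (brauerClass F A)) : P x :=
  Quotient.inductionOn x fun A => h A

/-- Tensor product of central simple algebras. -/
noncomputable def CSA.tensor (A B : CSA.{0, 0} F) : CSA.{0, 0} F :=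
  { AlgCat.of F (A ⊗[F] B) with
    isCentral := inferInstanceAs (Algebra.IsCentral F (A ⊗[F] B))
    isSimple := inferInstanceAs (IsSimpleRing (A ⊗[F] B))
    fin_dim := inferInstanceAs (FiniteDimensional F (A ⊗[F] B)) }

noncomputable instance : Mul (BrauerGroup.{0, 0} F) where
  mul := Quotient.map₂ CSA.tensor fun A A' h B B' h' => by
    have h₁ : IsBrauerEquiv F A A' := by
      simp only [IsBrauerEquiv, Nat.pos_iff_ne_zero]
      exact h
    have h₂ : IsBrauerEquiv F B B' := by
      simp only [IsBrauerEquiv, Nat.pos_iff_ne_zero]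
      exact h'
    have := h₁.tensor h₂
    simp only [IsBrauerEquiv, Nat.pos_iff_ne_zero] at this
    exact this

theorem brauerClass_tensor (A B : Type) [Ring A] [Algebra F A] [Algebra.IsCentral F A]
    [IsSimpleRing A] [FiniteDimensional F A] [Ring B] [Algebra F B] [Algebra.IsCentral F B]
    [IsSimpleRing B] [FiniteDimensional F B] :
    brauerClass F (A ⊗[F] B) = brauerClass F A * brauerClass F B := rfl

noncomputable instance : One (BrauerGroup.{0, 0} F) := ⟨brauerClass F F⟩

theorem brauerClass_self : brauerClass F F = 1 := rfl

theorem brauerClass_eq_one_of_algEquiv_end {A V : Type} [Ring A] [Algebra F A]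
    [Algebra.IsCentral F A] [IsSimpleRing A] [FiniteDimensional F A]
    [AddCommGroup V] [Module F V] [FiniteDimensional F V] [Nontrivial V]
    (e : A ≃ₐ[F] Module.End F V) : brauerClass F A = 1 := by
  rw [← brauerClass_self, brauerClass_eq_iff]
  have b := Module.finBasis F V
  have : NeZero (Module.finrank F V) := ⟨Module.finrank_pos.ne'⟩
  exact .of_algEquiv_matrix (e.trans (algEquivMatrix b))

/-- An algebra homomorphism from a simple algebra to a nonzero algebra of the same dimension is
an isomorphism. -/
noncomputable def AlgHom.equivOfFinrankEq {A B : Type*} [Ring A] [Algebra F A]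
    [IsSimpleRing A] [Ring B] [Algebra F B] [Nontrivial B]
    [FiniteDimensional F A] [FiniteDimensional F B] (f : A →ₐ[F] B)
    (h : Module.finrank F A = Module.finrank F B) : A ≃ₐ[F] B :=
  AlgEquiv.ofBijective f (by
    have hinj : Function.Injective f := f.toRingHom.injective
    exact ⟨hinj, (LinearMap.injective_iff_surjective_of_finrank_eq_finrank
      (f := f.toLinearMap) h).mp hinj⟩)

theorem brauerClass_mul_op (A : Type) [Ring A] [Algebra F A]
    [Algebra.IsCentral F A] [IsSimpleRing A] [FiniteDimensional F A] :
    brauerClass F A * brauerClass F Aᵐᵒᵖ = 1 := by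
  rw [← brauerClass_tensor]
  refine brauerClass_eq_one_of_algEquiv_end (V := A)
    ((AlgHom.mulLeftRight F A).equivOfFinrankEq ?_)
  rw [Module.finrank_tensorProduct, Module.finrank_linearMap,
    (MulOpposite.opLinearEquiv F (M := A)).finrank_eq]

noncomputable instance : Inv (BrauerGroup.{0, 0} F) := ⟨fun x => brauerClass F (x.out)ᵐᵒᵖ⟩

noncomputable instance : CommGroup (BrauerGroup.{0, 0} F) :=
  have hcomm (x y : BrauerGroup.{0, 0} F) : x * y = y * x := by
    induction x using BrauerGroup.ind_on with | h A
    induction y using BrauerGroup.ind_on with | h B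
    exact brauerClass_congr (Algebra.TensorProduct.comm F A B)
  have hone (x : BrauerGroup.{0, 0} F) : 1 * x = x := by
    induction x using BrauerGroup.ind_on with | h A
    exact brauerClass_congr (Algebra.TensorProduct.lid F A)
  have h_inv (X : CSA.{0, 0} F) :
      (Quotient.mk _ X : BrauerGroup.{0, 0} F) * brauerClass F Xᵐᵒᵖ = 1 :=
    @brauerClass_mul_op F _ X _ _ X.isCentral X.isSimple X.fin_dim
  { mul_assoc x y z := by
      induction x using BrauerGroup.ind_on with | h A
      induction y using BrauerGroup.ind_on with | h B
      induction z using BrauerGroup.ind_on with | h C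
      exact brauerClass_congr (Algebra.TensorProduct.assoc F F F A B C)
    one_mul := hone
    mul_one x := by rw [hcomm, hone]
    mul_comm := hcomm
    inv_mul_cancel x := by
      rw [hcomm]
      nth_rw 1 [← x.out_eq]
      exact h_inv x.out }

/-- Commuting algebra homomorphisms from central simple algebras into a central simple algebra
of complementary dimensions exhibit the latter as a tensor product. -/
theorem brauerClass_eq_mul_of_commute {A B E : Type} [Ring A] [Algebra F A]
    [Algebra.IsCentral F A] [IsSimpleRing A] [FiniteDimensional F A] [Ring B] [Algebra F B]
    [Algebra.IsCentral F B] [IsSimpleRing B] [FiniteDimensional F B] [Ring E] [Algebra F E]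
    [Algebra.IsCentral F E] [IsSimpleRing E] [FiniteDimensional F E]
    (f : A →ₐ[F] E) (g : B →ₐ[F] E) (hfg : ∀ a b, Commute (f a) (g b))
    (h : Module.finrank F A * Module.finrank F B = Module.finrank F E) :
    brauerClass F E = brauerClass F A * brauerClass F B := by
  rw [← brauerClass_tensor]
  refine (brauerClass_congr
    ((Algebra.TensorProduct.lift f g hfg).equivOfFinrankEq ?_)).symm
  rw [Module.finrank_tensorProduct, h]

end Brauer

section Brauer

variable {F : Type} [Field F]

/-- A central simple algebra with trivial Brauer class is the endomorphism algebra of a vector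
space. -/
theorem exists_algEquiv_end_of_brauerClass_eq_one {A : Type} [Ring A] [Algebra F A]
    [Algebra.IsCentral F A] [IsSimpleRing A] [FiniteDimensional F A]
    (h : brauerClass F A = 1) :
    ∃ (V : Type) (_ : AddCommGroup V) (_ : Module F V) (_ : FiniteDimensional F V)
      (_ : Nontrivial V), Nonempty (A ≃ₐ[F] Module.End F V) := by
  rw [← brauerClass_self, brauerClass_eq_iff] at h
  obtain ⟨n, m, hn, hm, ⟨e⟩⟩ := h
  have : NeZero n := ⟨hn.ne'⟩
  have : NeZero m := ⟨hm.ne'⟩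
  let φ : Matrix (Fin n) (Fin n) A ≃ₐ[F] Module.End F (Fin m → F) :=
    e.trans Matrix.toLinAlgEquiv'
  let E : Matrix (Fin n) (Fin n) A := Matrix.single 0 0 1
  let V : Submodule F (Fin m → F) := LinearMap.range (φ E)
  have hE (v : V) : φ E v = v := by
    obtain ⟨w, hw⟩ := v.2
    rw [← hw, ← Module.End.mul_apply, ← map_mul]
    simp [E]
  have hmem (a : A) (v) : φ (Matrix.single 0 0 a) v ∈ V :=
    ⟨φ (Matrix.single 0 0 a) v, by
      rw [← Module.End.mul_apply, ← map_mul]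
      simp [E]⟩
  let g : A →ₐ[F] Module.End F V :=
    { toFun a := (φ (Matrix.single 0 0 a)).restrict fun v _ => hmem a v
      map_one' := by
        ext1 v
        exact Subtype.ext (hE v)
      map_mul' a b := by
        ext1 v
        apply Subtype.ext
        simp only [LinearMap.coe_restrict_apply, Module.End.mul_apply]
        rw [← Module.End.mul_apply, ← map_mul]
        simp
      map_zero' := by
        ext1 v
        apply Subtype.ext
        simp
      map_add' a b := by
        ext1 v
        apply Subtype.ext
        simp [Matrix.single_add]
      commutes' r := by
        ext1 v
        apply Subtype.ext
        have : Matrix.single 0 0 (algebraMap F A r) = r • E := by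
          simp [E, Matrix.smul_single, Algebra.algebraMap_eq_smul_one]
        simp [this, hE] }
  have hV : Nontrivial V := by
    rw [Submodule.nontrivial_iff_ne_bot]
    intro h0
    have : φ E = 0 := LinearMap.range_eq_bot.mp h0
    have h1 : E = 0 := by simpa using this
    have := congrFun (congrFun h1 0) 0
    simp [E] at this
  refine ⟨V, inferInstance, inferInstance, inferInstance, hV,
    ⟨AlgEquiv.ofBijective g ⟨g.toRingHom.injective, fun f => ?_⟩⟩⟩
  let G : Module.End F (Fin m → F) := V.subtype ∘ₗ f ∘ₗ (φ E).rangeRestrict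
  obtain ⟨X, hX⟩ := φ.surjective G
  have hEX : E * X * E = X := by
    apply φ.injective
    rw [map_mul, map_mul, hX]
    refine LinearMap.ext fun w => ?_
    simp only [Module.End.mul_apply, G, LinearMap.comp_apply, Submodule.subtype_apply]
    rw [hE]
    congr 2
    apply Subtype.ext
    exact hE ⟨_, w, rfl⟩
  have hX0 : Matrix.single 0 0 (X 0 0) = X := by
    conv_rhs => rw [← hEX]
    simp [E]
  refine ⟨X 0 0, ?_⟩
  ext1 v
  apply Subtype.ext
  change φ (Matrix.single 0 0 (X 0 0)) v = f v
  rw [hX0, hX]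
  simp only [G, LinearMap.comp_apply, Submodule.subtype_apply]
  congr 2
  exact Subtype.ext (hE v)

end Brauer

section Restriction

variable (F L : Type) [Field F] [Field L] [Algebra F L]

theorem IsBrauerEquiv.baseChange {A B : Type} [Ring A] [Algebra F A] [Ring B] [Algebra F B]
    (h : IsBrauerEquiv F A B) : IsBrauerEquiv L (L ⊗[F] A) (L ⊗[F] B) := by
  obtain ⟨n, m, hn, hm, ⟨e⟩⟩ := h
  have : NeZero n := ⟨hn.ne'⟩
  have : NeZero m := ⟨hm.ne'⟩
  have key (C : Type) [Ring C] [Algebra F C] (k : ℕ) :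
      Nonempty (L ⊗[F] Matrix (Fin k) (Fin k) C ≃ₐ[L]
        Matrix (PUnit.{1} × Fin k) (PUnit.{1} × Fin k) (L ⊗[F] C)) :=
    ⟨(Algebra.TensorProduct.congr
      (Matrix.uniqueAlgEquiv (m := PUnit.{1}) (R := L) (A := L)).symm AlgEquiv.refl).trans
      (Matrix.kroneckerTMulAlgEquiv PUnit.{1} (Fin k) F L L C)⟩
  obtain ⟨e₁⟩ := key A n
  obtain ⟨e₂⟩ := key B m
  exact .of_matrix (e₁.symm.trans ((Algebra.TensorProduct.congr AlgEquiv.refl e).trans e₂))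

theorem brauerClass_baseChange_tensor (A B : Type) [Ring A] [Algebra F A]
    [Algebra.IsCentral F A] [IsSimpleRing A] [FiniteDimensional F A] [Ring B] [Algebra F B]
    [Algebra.IsCentral F B] [IsSimpleRing B] [FiniteDimensional F B] :
    brauerClass L (L ⊗[F] (A ⊗[F] B)) =
      brauerClass L (L ⊗[F] A) * brauerClass L (L ⊗[F] B) := by
  refine brauerClass_eq_mul_of_commute
    (Algebra.TensorProduct.map (AlgHom.id L L) Algebra.TensorProduct.includeLeft)
    (Algebra.TensorProduct.map (AlgHom.id L L) Algebra.TensorProduct.includeRight) ?_ ?_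
  · intro x y
    induction x with
    | zero => simp
    | add x z hx hz => rw [map_add]; exact hx.add_left hz
    | tmul l a =>
      induction y with
      | zero => simp
      | add y z hy hz => rw [map_add]; exact hy.add_right hz
      | tmul m b => simp [Commute, SemiconjBy, mul_comm]
  · simp only [Module.finrank_baseChange, Module.finrank_tensorProduct]

theorem brauerClass_baseChange_baseChange (M : Type) [Field M] [Algebra F M] [Algebra L M]
    [IsScalarTower F L M] (A : Type) [Ring A] [Algebra F A]
    [Algebra.IsCentral F A] [IsSimpleRing A] [FiniteDimensional F A] :
    brauerClass M (M ⊗[L] (L ⊗[F] A)) = brauerClass M (M ⊗[F] A) := by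
  refine brauerClass_congr (AlgHom.equivOfFinrankEq
    (Algebra.TensorProduct.lift (Algebra.TensorProduct.includeLeft : M →ₐ[M] M ⊗[F] A)
      (Algebra.TensorProduct.map (Algebra.ofId L M) (AlgHom.id F A) : L ⊗[F] A →ₐ[L] M ⊗[F] A)
      ?_) ?_)
  · intro x y
    induction y with
    | zero => simp
    | add y z hy hz => rw [map_add]; exact hy.add_right hz
    | tmul m b => simp [Commute, SemiconjBy, mul_comm]
  · simp only [Module.finrank_baseChange]

/-- Restriction of Brauer classes along a field extension. -/
noncomputable def BrauerGroup.res : BrauerGroup.{0, 0} F →* BrauerGroup.{0, 0} L :=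
  MonoidHom.mk' (Quotient.lift (fun A : CSA.{0, 0} F => brauerClass L (L ⊗[F] A))
    fun A B h => brauerClass_eq_iff.mpr (IsBrauerEquiv.baseChange F L (by
      simp only [IsBrauerEquiv, Nat.pos_iff_ne_zero]
      exact h))) (by
    intro x y
    induction x using BrauerGroup.ind_on with | h A
    induction y using BrauerGroup.ind_on with | h B
    exact brauerClass_baseChange_tensor F L A B)

theorem BrauerGroup.res_brauerClass (A : Type) [Ring A] [Algebra F A] [Algebra.IsCentral F A]
    [IsSimpleRing A] [FiniteDimensional F A] :
    BrauerGroup.res F L (brauerClass F A) = brauerClass L (L ⊗[F] A) := rfl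

theorem BrauerGroup.res_res (M : Type) [Field M] [Algebra F M] [Algebra L M]
    [IsScalarTower F L M] (x : BrauerGroup.{0, 0} F) :
    BrauerGroup.res L M (BrauerGroup.res F L x) = BrauerGroup.res F M x := by
  induction x using BrauerGroup.ind_on with | h A
  exact brauerClass_baseChange_baseChange F L M A

end Restriction

section PiTensor

variable {F : Type} [Field F]

open PiTensorProduct in
/-- A tensor product over `Fin (k + 1)` is the tensor product of the first factor with the tensor
product of the remaining factors. -/
theorem PiTensorProduct.nonempty_algEquiv_succ {k : ℕ} (D : Fin (k + 1) → Type)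
    [∀ i, Ring (D i)] [∀ i, Algebra F (D i)] [∀ i, FiniteDimensional F (D i)] :
    Nonempty ((⨂[F] i, D i) ≃ₐ[F] D 0 ⊗[F] (⨂[F] i : Fin k, D i.succ)) := by
  let g : D 0 →ₗ[F] MultilinearMap F (fun i : Fin k => D i.succ)
      (D 0 ⊗[F] (⨂[F] i : Fin k, D i.succ)) :=
    { toFun a := (TensorProduct.mk F (D 0) (⨂[F] i : Fin k, D i.succ) a).compMultilinearMap
        (tprod F)
      map_add' a b := by ext; simp
      map_smul' a b := by ext; simp [TensorProduct.smul_tmul'] }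
  let ψ : (⨂[F] i, D i) →ₐ[F] D 0 ⊗[F] (⨂[F] i : Fin k, D i.succ) :=
    liftAlgHom (LinearMap.uncurryLeft g) rfl fun x y => by
      simp [g, Fin.tail_def, tprod_mul_tprod, Pi.mul_def]
  have hsurj : Function.Surjective ψ := by
    rw [← AlgHom.range_eq_top, eq_top_iff]
    rintro x -
    induction x with
    | zero => exact zero_mem _
    | add x y hx hy => exact add_mem hx hy
    | tmul a t =>
      induction t using PiTensorProduct.induction_on with
      | smul_tprod r f =>
        refine ⟨r • tprod F (Fin.cons a f), ?_⟩
        change ψ _ = _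
        rw [map_smul]
        rw [TensorProduct.tmul_smul]
        congr 1
        exact (PiTensorProduct.lift.tprod _).trans rfl
      | add x y hx hy => rw [TensorProduct.tmul_add]; exact add_mem hx hy
  have hfin (n : ℕ) (E : Fin n → Type) [∀ i, Ring (E i)] [∀ i, Algebra F (E i)]
      [∀ i, FiniteDimensional F (E i)] :
      FiniteDimensional F (⨂[F] i, E i) ∧
      Module.finrank F (⨂[F] i, E i) = ∏ i, Module.finrank F (E i) := by
    let b := Basis.piTensorProduct fun i => Module.finBasis F (E i)
    refine ⟨Module.Basis.finiteDimensional_of_finite b, ?_⟩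
    rw [Module.finrank_eq_card_basis b]
    simp
  have h₁ := hfin _ D
  have h₂ := hfin _ fun i : Fin k => D i.succ
  have := h₁.1
  have := h₂.1
  refine ⟨AlgEquiv.ofBijective ψ ⟨?_, hsurj⟩⟩
  refine (LinearMap.injective_iff_surjective_of_finrank_eq_finrank (f := ψ.toLinearMap) ?_).mpr
    hsurj
  rw [h₁.2, Module.finrank_tensorProduct, h₂.2, Fin.prod_univ_succ]

theorem PiTensorProduct.nonempty_algEquiv_zero (D : Fin 0 → Type)
    [∀ i, Ring (D i)] [∀ i, Algebra F (D i)] : Nonempty ((⨂[F] i, D i) ≃ₐ[F] F) := by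
  refine ⟨AlgEquiv.ofLinearEquiv (PiTensorProduct.isEmptyEquiv (Fin 0)) ?_ ?_⟩
  · rw [PiTensorProduct.one_def]; simp
  · intro x y
    induction x using PiTensorProduct.induction_on with
    | smul_tprod r f =>
      induction y using PiTensorProduct.induction_on with
      | smul_tprod s g => simp [mul_comm]
      | add y z hy hz => rw [mul_add, map_add, map_add, hy, hz, mul_add]
    | add x z hx hz => rw [add_mul, map_add, map_add, hx, hz, add_mul]

/-- A finite tensor product of central simple algebras is central simple, and its Brauer class is
the product of the classes of the factors. -/
theorem brauerClass_piTensorProduct {k : ℕ} (D : Fin k → Type)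
    [∀ i, Ring (D i)] [∀ i, Algebra F (D i)] [∀ i, FiniteDimensional F (D i)]
    [∀ i, IsSimpleRing (D i)] [∀ i, Algebra.IsCentral F (D i)] :
    ∃ (_ : FiniteDimensional F (⨂[F] i, D i)) (_ : IsSimpleRing (⨂[F] i, D i))
      (_ : Algebra.IsCentral F (⨂[F] i, D i)),
      brauerClass F (⨂[F] i, D i) = ∏ i, brauerClass F (D i) := by
  induction k with
  | zero =>
    obtain ⟨e⟩ := PiTensorProduct.nonempty_algEquiv_zero (F := F) D
    refine ⟨e.symm.toLinearEquiv.finiteDimensional, .of_ringEquiv e.symm.toRingEquiv inferInstance,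
      .of_algEquiv _ _ _ e.symm, ?_⟩
    have := e.symm.toLinearEquiv.finiteDimensional
    have := IsSimpleRing.of_ringEquiv e.symm.toRingEquiv inferInstance
    have := Algebra.IsCentral.of_algEquiv _ _ _ e.symm
    rw [Fin.prod_univ_zero, ← brauerClass_self]
    exact brauerClass_congr e
  | succ k ih =>
    obtain ⟨e⟩ := PiTensorProduct.nonempty_algEquiv_succ (F := F) D
    obtain ⟨_, _, _, h⟩ := ih fun i => D i.succ
    have i₁ := e.symm.toLinearEquiv.finiteDimensional
    have i₂ := IsSimpleRing.of_ringEquiv e.symm.toRingEquiv inferInstance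
    have i₃ := Algebra.IsCentral.of_algEquiv _ _ _ e.symm
    refine ⟨i₁, i₂, i₃, ?_⟩
    rw [Fin.prod_univ_succ, ← h, ← brauerClass_tensor]
    exact brauerClass_congr e

end PiTensor

/-- The defining relations of the symbol algebra `[a, b)`. -/
structure IsSymbolPair (p : ℕ) {F D : Type*} [Field F] [Ring D] [Algebra F D] (a b : F)
    (i j : D) : Prop where
  i_pow : i ^ p - i = algebraMap F D a
  j_pow : j ^ p = algebraMap F D b
  rel : j * i = (i - 1) * j

namespace IsSymbolPair

open Polynomial

variable {p : ℕ} [Fact p.Prime] {F D : Type*} [Field F] [CharP F p] [Ring D] [Algebra F D]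
  {a b : F} {i j : D}

theorem map {E : Type*} [Ring E] [Algebra F E] (h : IsSymbolPair p a b i j) (f : D →ₐ[F] E) :
    IsSymbolPair p a b (f i) (f j) where
  i_pow := by rw [← map_pow, ← map_sub, h.i_pow, f.commutes]
  j_pow := by rw [← map_pow, h.j_pow, f.commutes]
  rel := by rw [← map_mul, h.rel, map_mul, map_sub, map_one]

theorem isUnit (h : IsSymbolPair p a b i j) (hp : p ≠ 0) (hb : b ≠ 0) : IsUnit j := by
  have : IsUnit (j ^ p) := by
    rw [h.j_pow]
    exact (IsUnit.mk0 b hb).map (algebraMap F D)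
  exact (isUnit_pow_iff hp).mp this

theorem aeval_mul (h : IsSymbolPair p a b i j) (f : F[X]) :
    aeval i f * j = j * aeval i (taylor 1 f) := by
  rw [taylor_apply, aeval_comp]
  induction f using Polynomial.induction_on' with
  | add f g hf hg => simp only [map_add, add_mul, mul_add, hf, hg]
  | monomial n r =>
    have h1 : SemiconjBy j (i + 1) i := by
      rw [SemiconjBy, mul_add, h.rel]
      noncomm_ring
    have h2 := (h1.pow_right n).eq
    simp only [aeval_monomial, map_add, aeval_X, map_one]
    rw [mul_assoc, ← h2, ← mul_assoc, ← mul_assoc, (Algebra.commutes r j).symm]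

theorem mul_aeval (h : IsSymbolPair p a b i j) (f : F[X]) :
    j * aeval i f = aeval i (taylor (-1) f) * j := by
  rw [h.aeval_mul, taylor_taylor]
  simp

theorem eq_C_of_taylor {f : F[X]} (hf : f.degree < p) (h : taylor 1 f = f) :
    ∃ c, f = C c := by
  classical
  refine ⟨f.eval 0, ?_⟩
  have hev (k : ℕ) : f.eval (k : F) = f.eval 0 := by
    induction k with
    | zero => simp
    | succ k ih => rw [← ih, Nat.cast_succ, ← taylor_eval, h]
  refine eq_of_degree_sub_lt_of_eval_finset_eq ((Finset.range p).image (fun k : ℕ => (k : F)))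
    ?_ ?_
  · rw [Finset.card_image_of_injOn, Finset.card_range]
    · refine lt_of_le_of_lt (degree_sub_le _ _) (max_lt hf ?_)
      exact lt_of_le_of_lt degree_C_le (by exact_mod_cast (Fact.out : p.Prime).pos)
    · intro x hx y hy hxy
      exact CharP.natCast_injOn_Iio F p (by simpa using hx) (by simpa using hy) hxy
  · intro x hx
    obtain ⟨k, -, rfl⟩ := Finset.mem_image.mp hx
    simp [hev]

theorem eq_zero_of_aeval (h : IsSymbolPair p a b i j) [Nontrivial D] (hb : b ≠ 0) {f : F[X]}
    (hf : f.degree < p) (h0 : aeval i f = 0) : f = 0 := by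
  induction hn : f.natDegree using Nat.strong_induction_on generalizing f with
  | _ n ih =>
    by_contra hne
    have hj := h.isUnit (Fact.out : p.Prime).ne_zero hb
    have h1 : aeval i (taylor 1 f) = 0 := by
      have := h.aeval_mul f
      rw [h0, zero_mul] at this
      exact (hj.mul_right_eq_zero).mp this.symm
    have hlt : (taylor 1 f - f).degree < f.degree :=
      (degree_taylor f 1) ▸ degree_sub_lt_left (degree_taylor f 1)
        (by rwa [Ne, taylor_eq_zero]) (leadingCoeff_taylor 1 f)
    have h2 : taylor 1 f - f = 0 := by
      by_contra hne'
      exact hne' (ih _ (hn ▸ natDegree_lt_natDegree hne' hlt) (hlt.trans hf)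
        (by rw [map_sub, h1, h0, sub_zero]) rfl)
    obtain ⟨c, rfl⟩ := eq_C_of_taylor hf (sub_eq_zero.mp h2)
    simp only [aeval_C] at h0
    rw [map_eq_zero_iff _ (FaithfulSMul.algebraMap_injective F D)] at h0
    exact hne (by simp [h0])

theorem i_mul_j_pow (h : IsSymbolPair p a b i j) (t : ℕ) :
    i * j ^ t - j ^ t * i = (t : F) • j ^ t := by
  induction t with
  | zero => simp
  | succ t ih =>
    have h1 : i * j = j * i + j := by rw [h.rel]; noncomm_ring
    have : i * j ^ (t + 1) - j ^ (t + 1) * i = (i * j ^ t - j ^ t * i) * j + j ^ t * j := by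
      have : j ^ t * (i * j) = j ^ t * (j * i) + j ^ t * j := by rw [h1, mul_add]
      rw [pow_succ, sub_mul, mul_assoc (j ^ t) i j, this]
      noncomm_ring
    rw [this, ih, pow_succ]
    simp [add_smul]

theorem eq_zero_of_sum (h : IsSymbolPair p a b i j) [Nontrivial D] (hb : b ≠ 0)
    {f : Fin p → F[X]} (hf : ∀ t, (f t).degree < p)
    (h0 : ∑ t, aeval i (f t) * j ^ (t : ℕ) = 0) : f = 0 := by
  let ad : Module.End F D := LinearMap.mulLeft F i - LinearMap.mulRight F i
  have hind := (iSupIndep_iff_finsetSum_eq_zero_imp_eq_zero _).mp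
    ((Module.End.eigenspaces_iSupIndep ad).comp (f := fun t : Fin p => ((t : ℕ) : F))
      fun x y hxy => Fin.ext (CharP.natCast_injOn_Iio F p x.2 y.2 hxy))
    Finset.univ (fun t => aeval i (f t) * j ^ (t : ℕ)) (fun t _ => by
      simp only [Function.comp, Module.End.mem_eigenspace_iff, ad, LinearMap.sub_apply,
        LinearMap.mulLeft_apply, LinearMap.mulRight_apply]
      have hc : i * aeval i (f t) = aeval i (f t) * i := by
        simpa using congrArg (aeval i) (mul_comm X (f t))
      rw [← mul_assoc, hc, mul_assoc, mul_assoc, ← mul_sub, h.i_mul_j_pow, mul_smul_comm]) h0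
  funext t
  refine h.eq_zero_of_aeval hb (hf t) ?_
  have hj := (h.isUnit (Fact.out : p.Prime).ne_zero hb).pow (t : ℕ)
  exact hj.mul_left_eq_zero.mp (hind t (Finset.mem_univ _))

variable (p i j) in
/-- The linear map sending coefficients `f` to `∑ f_t(i) j ^ t`. -/
noncomputable def linearMap (F : Type*) [Field F] [Algebra F D] :
    (Fin p → degreeLT F p) →ₗ[F] D :=
  ∑ t : Fin p, LinearMap.mulRight F (j ^ (t : ℕ)) ∘ₗ (aeval i).toLinearMap ∘ₗ
    (degreeLT F p).subtype ∘ₗ LinearMap.proj t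

theorem linearMap_apply (f : Fin p → degreeLT F p) :
    linearMap p i j F f = ∑ t, aeval i (f t : F[X]) * j ^ (t : ℕ) := by
  simp [linearMap]

theorem linearMap_injective (h : IsSymbolPair p a b i j) [Nontrivial D] (hb : b ≠ 0) :
    Function.Injective (linearMap p i j F) := by
  rw [injective_iff_map_eq_zero]
  intro f hf
  rw [linearMap_apply] at hf
  have := h.eq_zero_of_sum hb (fun t => mem_degreeLT.mp (f t).2) hf
  funext t
  exact Subtype.ext (congrFun this t)

theorem linearMap_surjective (h : IsSymbolPair p a b i j) (hadj : Algebra.adjoin F {i, j} = ⊤) :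
    Function.Surjective (linearMap p i j F) := by
  have hp := (Fact.out : p.Prime)
  have hmem (f : F[X]) (t : ℕ) : aeval i f * j ^ t ∈ LinearMap.range (linearMap p i j F) := by
    have hm : (X ^ p - X - C a : F[X]).Monic := by
      rw [sub_sub]
      refine monic_X_pow_sub ?_
      refine (degree_add_le _ _).trans_lt (max_lt (degree_X_le.trans_lt ?_)
        (degree_C_le.trans_lt ?_)) <;> exact_mod_cast (by first | exact hp.one_lt | exact hp.pos)
    have hdeg : (X ^ p - X - C a : F[X]).degree = p := by
      rw [sub_sub, degree_sub_eq_left_of_degree_lt, degree_X_pow]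
      rw [degree_X_pow]
      refine (degree_add_le _ _).trans_lt (max_lt (degree_X_le.trans_lt ?_)
        (degree_C_le.trans_lt ?_)) <;> exact_mod_cast (by first | exact hp.one_lt | exact hp.pos)
    have h1 : aeval i f = aeval i (f %ₘ (X ^ p - X - C a)) := by
      conv_lhs => rw [← modByMonic_add_div f (X ^ p - X - C a)]
      simp [h.i_pow]
    have h2 : j ^ t = b ^ (t / p) • j ^ (t % p) := by
      conv_lhs => rw [← Nat.div_add_mod t p, pow_add, pow_mul, h.j_pow, ← map_pow]
      rw [Algebra.smul_def]
    rw [h1, h2, mul_smul_comm]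
    refine Submodule.smul_mem _ _ ⟨Pi.single ⟨t % p, Nat.mod_lt _ hp.pos⟩
      ⟨f %ₘ (X ^ p - X - C a), mem_degreeLT.mpr
        (hdeg ▸ degree_modByMonic_lt f hm)⟩, ?_⟩
    rw [linearMap_apply, Finset.sum_eq_single ⟨t % p, Nat.mod_lt _ hp.pos⟩]
    · simp
    · intro s _ hs
      simp [hs]
    · simp
  let S : Submodule F D := Submodule.span F {x | ∃ (f : F[X]) (t : ℕ), x = aeval i f * j ^ t}
  have hS : S ≤ LinearMap.range (linearMap p i j F) := by
    refine Submodule.span_le.mpr ?_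
    rintro _ ⟨f, t, rfl⟩
    exact hmem f t
  have hSi (x : D) (hx : x ∈ S) : i * x ∈ S := by
    induction hx using Submodule.span_induction with
    | mem x hx =>
      obtain ⟨f, t, rfl⟩ := hx
      exact Submodule.subset_span ⟨X * f, t, by simp [mul_assoc]⟩
    | zero => simp
    | add x y _ _ hx hy => rw [mul_add]; exact add_mem hx hy
    | smul r x _ hx => rw [mul_smul_comm]; exact Submodule.smul_mem _ _ hx
  have hSj (x : D) (hx : x ∈ S) : j * x ∈ S := by
    induction hx using Submodule.span_induction with
    | mem x hx =>
      obtain ⟨f, t, rfl⟩ := hx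
      exact Submodule.subset_span ⟨taylor (-1) f, t + 1, by
        rw [← mul_assoc, h.mul_aeval, mul_assoc, pow_succ']⟩
    | zero => simp
    | add x y _ _ hx hy => rw [mul_add]; exact add_mem hx hy
    | smul r x _ hx => rw [mul_smul_comm]; exact Submodule.smul_mem _ _ hx
  have hall (y : D) : ∀ x ∈ S, y * x ∈ S := by
    have hy : y ∈ Algebra.adjoin F {i, j} := hadj ▸ Algebra.mem_top
    induction hy using Algebra.adjoin_induction with
    | mem y hy =>
      rcases hy with rfl | rfl
      · exact hSi
      · exact hSj
    | algebraMap r =>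
      intro x hx
      rw [← Algebra.smul_def]
      exact Submodule.smul_mem _ _ hx
    | add y z _ _ hy hz =>
      intro x hx
      rw [add_mul]
      exact add_mem (hy x hx) (hz x hx)
    | mul y z _ _ hy hz =>
      intro x hx
      rw [mul_assoc]
      exact hy _ (hz x hx)
  intro y
  refine hS ?_
  simpa using hall y 1 (Submodule.subset_span ⟨1, 0, by simp⟩)

theorem finrank_coeff : Module.finrank F (Fin p → degreeLT F p) = p ^ 2 := by
  rw [Module.finrank_pi_fintype]
  simp [(degreeLTEquiv F p).finrank_eq, sq]

theorem finiteDimensional_coeff : FiniteDimensional F (Fin p → degreeLT F p) :=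
  have := (degreeLTEquiv F p).symm.finiteDimensional
  inferInstance

theorem finiteDimensional (h : IsSymbolPair p a b i j) (hadj : Algebra.adjoin F {i, j} = ⊤) :
    FiniteDimensional F D :=
  have := finiteDimensional_coeff (p := p) (F := F)
  Module.Finite.of_surjective _ (h.linearMap_surjective hadj)

theorem finrank_eq (h : IsSymbolPair p a b i j) [Nontrivial D] (hb : b ≠ 0)
    (hadj : Algebra.adjoin F {i, j} = ⊤) : Module.finrank F D = p ^ 2 := by
  rw [← finrank_coeff (F := F), LinearEquiv.finrank_eq (LinearEquiv.ofBijective _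
    ⟨h.linearMap_injective hb, h.linearMap_surjective hadj⟩)]

theorem algHom_injective {E : Type*} [Ring E] [Algebra F E] [Nontrivial E]
    (h : IsSymbolPair p a b i j) (hb : b ≠ 0) (hadj : Algebra.adjoin F {i, j} = ⊤)
    (g : D →ₐ[F] E) : Function.Injective g := by
  have hg : g.toLinearMap ∘ₗ linearMap p i j F = linearMap p (g i) (g j) F := by
    refine LinearMap.ext fun f => ?_
    simp [linearMap_apply, aeval_algHom_apply]
  have h1 := (h.map g).linearMap_injective hb
  rw [← hg] at h1
  intro x y hxy
  obtain ⟨u, rfl⟩ := h.linearMap_surjective hadj x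
  obtain ⟨v, rfl⟩ := h.linearMap_surjective hadj y
  exact congrArg _ (h1 hxy)

theorem isSimpleRing (h : IsSymbolPair p a b i j) [Nontrivial D] (hb : b ≠ 0)
    (hadj : Algebra.adjoin F {i, j} = ⊤) : IsSimpleRing D := by
  refine IsSimpleRing.of_eq_bot_or_eq_top fun I => or_iff_not_imp_right.mpr fun hI => ?_
  let g : D →ₐ[F] I.ringCon.Quotient :=
    { I.ringCon.mk' with commutes' := fun _ => rfl }
  have hg (x : D) : g x = 0 ↔ x ∈ I := by
    have := TwoSidedIdeal.mem_ker (f := I.ringCon.mk') (x := x)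
    rw [TwoSidedIdeal.ker_ringCon_mk'] at this
    exact this.symm
  have : Nontrivial I.ringCon.Quotient := by
    refine ⟨⟨g 1, 0, fun h1 => hI ?_⟩⟩
    exact (TwoSidedIdeal.one_mem_iff I).mp ((hg 1).mp h1)
  refine le_bot_iff.mp fun x hx => (TwoSidedIdeal.mem_bot _).mpr ?_
  exact h.algHom_injective hb hadj g (by rw [map_zero]; exact (hg x).mpr hx)

theorem isCentral (h : IsSymbolPair p a b i j) [Nontrivial D] (hb : b ≠ 0)
    (hadj : Algebra.adjoin F {i, j} = ⊤) : Algebra.IsCentral F D where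
  out x hx := by
    have hp := (Fact.out : p.Prime)
    rw [Subalgebra.mem_center_iff] at hx
    obtain ⟨f, rfl⟩ := h.linearMap_surjective hadj x
    have hfd (t) : (f t : F[X]).degree < p := mem_degreeLT.mp (f t).2
    have hc (g : F[X]) : i * aeval i g = aeval i g * i := by
      simpa using congrArg (aeval i) (mul_comm X g)
    have h1 : ∑ t : Fin p, aeval i (((t : ℕ) : F) • (f t : F[X])) * j ^ (t : ℕ) = 0 := by
      rw [← sub_eq_zero.mpr (hx i), linearMap_apply, Finset.mul_sum, Finset.sum_mul,
        ← Finset.sum_sub_distrib]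
      refine Finset.sum_congr rfl fun t _ => ?_
      rw [← mul_assoc, hc, mul_assoc, mul_assoc, ← mul_sub, h.i_mul_j_pow, mul_smul_comm,
        map_smul, smul_mul_assoc]
    have h2 := h.eq_zero_of_sum hb (fun t => (degree_smul_le _ _).trans_lt (hfd t)) h1
    have h3 (t : Fin p) (ht : t ≠ ⟨0, hp.pos⟩) : (f t : F[X]) = 0 := by
      have := congrFun h2 t
      simp only [Pi.zero_apply, smul_eq_zero] at this
      refine this.resolve_left fun h0 => ht (Fin.ext ?_)
      rw [CharP.cast_eq_zero_iff F p] at h0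
      exact Nat.eq_zero_of_dvd_of_lt h0 t.2
    have h4 : linearMap p i j F f = aeval i (f ⟨0, hp.pos⟩ : F[X]) := by
      rw [linearMap_apply, Finset.sum_eq_single ⟨0, hp.pos⟩]
      · simp
      · intro t _ ht
        simp [h3 t ht]
      · simp
    have hj := h.isUnit hp.ne_zero hb
    have h5 : taylor 1 (f ⟨0, hp.pos⟩ : F[X]) = f ⟨0, hp.pos⟩ := by
      rw [← sub_eq_zero]
      refine h.eq_zero_of_aeval hb ((degree_sub_le _ _).trans_lt
        (max_lt (by rw [degree_taylor]; exact hfd _) (hfd _))) ?_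
      have := hx j
      rw [h4, h.aeval_mul] at this
      rw [map_sub, sub_eq_zero]
      exact (hj.mul_left_cancel this).symm
    obtain ⟨c, hc'⟩ := eq_C_of_taylor (hfd _) h5
    exact ⟨c, by rw [h4, hc', aeval_C]; rfl⟩

end IsSymbolPair

section ArtinSchreier

open Polynomial

variable {p : ℕ} [Fact p.Prime] {D : Type*} [Ring D] [Algebra (ZMod p) D]

theorem prod_X_sub_natCast_range :
    ∏ k ∈ Finset.range p, (X - C (k : ZMod p)) = X ^ p - X := by
  have h1 : ∏ k ∈ Finset.range p, (X - C (k : ZMod p)) = ∏ x : ZMod p, (X - C x) := by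
    refine Finset.prod_bij (fun k _ => (k : ZMod p)) (fun _ _ => Finset.mem_univ _) ?_ ?_ ?_
    · intro x hx y hy hxy
      exact CharP.natCast_injOn_Iio (ZMod p) p (by simpa using hx) (by simpa using hy) hxy
    · intro x _
      exact ⟨x.val, Finset.mem_range.mpr x.val_lt, ZMod.natCast_zmod_val x⟩
    · intros; rfl
  have hp := (Fact.out : p.Prime)
  have hm : (X ^ p - X : (ZMod p)[X]).Monic :=
    monic_X_pow_sub (degree_X_le.trans_lt (by exact_mod_cast hp.one_lt))
  have hr : (X ^ p - X : (ZMod p)[X]).roots = Finset.univ.val := by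
    simpa using FiniteField.roots_X_pow_card_sub_X (ZMod p)
  rw [h1, ← Polynomial.prod_multiset_X_sub_C_of_monic_of_roots_card_eq hm, hr]
  · rfl
  · rw [hr, FiniteField.X_pow_card_sub_X_natDegree_eq _ hp.one_lt]
    simp

theorem mul_pow_of_commutator {D : Type*} [Ring D] {i v : D} (h : i * v = v * i + v) (m : ℕ) :
    i * v ^ m = v ^ m * i + m * v ^ m := by
  induction m with
  | zero => simp
  | succ m ih =>
    rw [pow_succ, ← mul_assoc, ih, add_mul, mul_assoc, h]
    push_cast
    noncomm_ring

/-- If `[i, v] = v` in characteristic `p`, then the Artin-Schreier power of `i` commutes with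
`v`. -/
theorem commute_pow_sub_of_commutator {D : Type*} [Ring D] [CharP D p] {i v : D}
    (h : i * v = v * i + v) : Commute (i ^ p - i) v := by
  have h1 : SemiconjBy v (i + 1) i := by
    rw [SemiconjBy, mul_add, mul_one, h]
  have h2 := (h1.pow_right p).eq
  rw [add_pow_char_of_commute _ (Commute.one_right i), one_pow, mul_add, mul_one] at h2
  rw [Commute, SemiconjBy, sub_mul, ← h2, h, mul_sub]
  abel

/-- If `[i, v] = v` in characteristic `p`, then `i + v` has the Artin-Schreier power
`i ^ p - i + v ^ p`. -/
theorem add_pow_sub_of_commutator {i v : D} (h : i * v = v * i + v) :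
    (i + v) ^ p - (i + v) = i ^ p - i + v ^ p := by
  let ff (n : ℕ) (x : D) : D := aeval x (∏ k ∈ Finset.range n, (X - C (k : ZMod p)))
  have hff (n : ℕ) (x : D) : ff (n + 1) x = (x - n) * ff n x := by
    simp only [ff, Finset.prod_range_succ]
    rw [mul_comm, map_mul]
    simp
  have hv (m : ℕ) := mul_pow_of_commutator h m
  have key (n : ℕ) : ff n (i + v) =
      ∑ x ∈ Finset.HasAntidiagonal.antidiagonal n, (n.choose x.1 : D) * (v ^ x.1 * ff x.2 i) := by
    induction n with
    | zero => simp [ff]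
    | succ n ih =>
      rw [Finset.sum_antidiagonal_choose_succ_mul (fun m k => v ^ m * ff k i), hff, ih,
        Finset.mul_sum, ← Finset.sum_add_distrib]
      refine Finset.sum_congr rfl fun x hx => ?_
      rw [Finset.HasAntidiagonal.mem_antidiagonal] at hx
      have hch : n.choose x.2 = n.choose x.1 := by
        rw [← hx, Nat.choose_symm_add]
      rw [hch, hff, pow_succ', ← mul_add, ← mul_assoc, ← Nat.cast_comm, mul_assoc]
      congr 1
      rw [← mul_assoc, sub_mul, add_mul, hv, ← hx]
      have : ((x.2 : ℕ) : D) * v ^ x.1 = v ^ x.1 * (x.2 : D) := Nat.cast_comm _ _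
      push_cast
      rw [add_mul, this]
      noncomm_ring
  have hffp (x : D) : ff p x = x ^ p - x := by
    simp only [ff, prod_X_sub_natCast_range]
    simp
  have hp := (Fact.out : p.Prime)
  have h0 := key p
  rw [hffp, Finset.Nat.sum_antidiagonal_eq_sum_range_succ_mk, Finset.sum_range_succ,
    Finset.sum_eq_single 0] at h0
  · have hff0 : ff 0 i = 1 := by simp [ff]
    clear_value ff
    simpa [hffp, hff0] using h0
  · intro m hm hm0
    have : ((p.choose m : ℕ) : D) = 0 := by
      obtain ⟨c, hc⟩ := hp.dvd_choose_self hm0 (Finset.mem_range.mp hm)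
      have := congrArg (algebraMap (ZMod p) D) (CharP.cast_eq_zero (ZMod p) p)
      rw [map_natCast, map_zero] at this
      simp [hc, this]
    simp [this]
  · intro h
    exact absurd (Finset.mem_range.mpr hp.pos) h

/-- Variant of `add_pow_sub_of_commutator` for an arbitrary nonzero eigenvalue in the prime
field. -/
theorem add_pow_sub_of_commutator_smul {i v : D} (k : ZMod p) (hk : k ≠ 0)
    (h : i * v = v * i + k • v) :
    (i + v) ^ p - (i + v) = i ^ p - i + v ^ p := by
  have h1 : (k⁻¹ • i) * (k⁻¹ • v) = (k⁻¹ • v) * (k⁻¹ • i) + k⁻¹ • v := by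
    simp only [smul_mul_smul_comm]
    rw [h, smul_add, smul_smul, mul_assoc, inv_mul_cancel₀ hk, mul_one]
  have h2 := congrArg (k • ·) (add_pow_sub_of_commutator (p := p) h1)
  rw [← smul_add, _root_.smul_pow, _root_.smul_pow, _root_.smul_pow, ZMod.pow_card] at h2
  simpa only [← smul_sub, ← smul_add, smul_smul, mul_inv_cancel₀ hk, one_smul] using h2

end ArtinSchreier

section SymbolAlgebra

variable (p : ℕ) (F : Type) [Field F] (a b : F)

/-- The relations presenting the symbol algebra `[a, b)`; `true` stands for `i` and `false`
for `j`. -/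
inductive SymbolAlg.Rel : FreeAlgebra F Bool → FreeAlgebra F Bool → Prop
  | i_pow : Rel (FreeAlgebra.ι F true ^ p - FreeAlgebra.ι F true) (algebraMap F _ a)
  | j_pow : Rel (FreeAlgebra.ι F false ^ p) (algebraMap F _ b)
  | rel : Rel (FreeAlgebra.ι F false * FreeAlgebra.ι F true)
      ((FreeAlgebra.ι F true - 1) * FreeAlgebra.ι F false)

/-- The symbol algebra `[a, b)` given by generators and relations. -/
abbrev SymbolAlg : Type := RingQuot (SymbolAlg.Rel p F a b)

namespace SymbolAlg

/-- The Artin-Schreier generator. -/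
noncomputable def i : SymbolAlg p F a b := RingQuot.mkAlgHom F _ (FreeAlgebra.ι F true)

/-- The radical generator. -/
noncomputable def j : SymbolAlg p F a b := RingQuot.mkAlgHom F _ (FreeAlgebra.ι F false)

theorem isSymbolPair : IsSymbolPair p a b (i p F a b) (j p F a b) where
  i_pow := by
    have := RingQuot.mkAlgHom_rel F (Rel.i_pow (p := p) (F := F) (a := a) (b := b))
    rw [map_sub, map_pow, AlgHom.commutes] at this
    exact this
  j_pow := by
    have := RingQuot.mkAlgHom_rel F (Rel.j_pow (p := p) (F := F) (a := a) (b := b))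
    rw [map_pow, AlgHom.commutes] at this
    exact this
  rel := by
    have := RingQuot.mkAlgHom_rel F (Rel.rel (p := p) (F := F) (a := a) (b := b))
    rw [map_mul, map_mul, map_sub, map_one] at this
    exact this

theorem adjoin_eq_top : Algebra.adjoin F {i p F a b, j p F a b} = ⊤ := by
  have h := FreeAlgebra.adjoin_range_ι F Bool
  have h2 := congrArg (Subalgebra.map (RingQuot.mkAlgHom F (Rel p F a b))) h
  rw [AlgHom.map_adjoin, Algebra.map_top, (AlgHom.range_eq_top _).mpr
    (RingQuot.mkAlgHom_surjective F _)] at h2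
  rw [← h2]
  congr 1
  rw [← Set.range_comp]
  ext x
  simp only [Set.mem_range, Bool.exists_bool, i, j, Function.comp, Set.mem_insert_iff,
    Set.mem_singleton_iff, eq_comm (a := x)]
  exact or_comm

variable {p F a b}

/-- The map out of a symbol algebra defined by a pair satisfying the symbol relations. -/
noncomputable def lift {D : Type*} [Ring D] [Algebra F D] {x y : D}
    (h : IsSymbolPair p a b x y) : SymbolAlg p F a b →ₐ[F] D :=
  RingQuot.liftAlgHom F ⟨FreeAlgebra.lift F (fun t => bif t then x else y), by
    rintro _ _ (_ | _ | _)
    · simpa using h.i_pow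
    · simpa using h.j_pow
    · simpa using h.rel⟩

theorem lift_i {D : Type*} [Ring D] [Algebra F D] {x y : D}
    (h : IsSymbolPair p a b x y) : lift h (i p F a b) = x := by
  simp [lift, i]

theorem lift_j {D : Type*} [Ring D] [Algebra F D] {x y : D}
    (h : IsSymbolPair p a b x y) : lift h (j p F a b) = y := by
  simp [lift, j]

end SymbolAlg

variable {p F a b} [Fact p.Prime] [CharP F p]

theorem IsSymbolPair.exists_end {E : Type*} [Field E] [Algebra F E] {c d : E}
    (hc : c ^ p - c = algebraMap F E a) (hd : d ^ p = algebraMap F E b) :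
    ∃ i j : Module.End E (ZMod p → E), IsSymbolPair p a b i j := by
  have : CharP E p := charP_of_injective_algebraMap (algebraMap F E).injective p
  let g : ZMod p → E := fun k => c + ZMod.castHom (dvd_refl p) E k
  let i : Module.End E (ZMod p → E) :=
    { toFun := fun f k => g k * f k
      map_add' := fun _ _ => by ext; simp [mul_add]
      map_smul' := fun _ _ => by ext; simp [mul_left_comm] }
  let j : Module.End E (ZMod p → E) :=
    { toFun := fun f k => d * f (k - 1)
      map_add' := fun _ _ => by ext; simp [mul_add]
      map_smul' := fun _ _ => by ext; simp [mul_left_comm] }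
  have hi (n : ℕ) (f : ZMod p → E) (k : ZMod p) : (i ^ n) f k = g k ^ n * f k := by
    induction n with
    | zero => simp
    | succ n ih =>
      rw [pow_succ', Module.End.mul_apply, pow_succ', mul_assoc, ← ih]
      rfl
  have hj (n : ℕ) (f : ZMod p → E) (k : ZMod p) : (j ^ n) f k = d ^ n * f (k - n) := by
    induction n generalizing k with
    | zero => simp
    | succ n ih =>
      rw [pow_succ', Module.End.mul_apply, pow_succ', mul_assoc]
      change d * (j ^ n) f (k - 1) = _
      rw [ih, Nat.cast_succ, sub_sub, add_comm (1 : ZMod p)]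
  refine ⟨i, j, ?_, ?_, ?_⟩
  · refine LinearMap.ext fun f => funext fun k => ?_
    rw [LinearMap.sub_apply, Pi.sub_apply, hi]
    change g k ^ p * f k - g k * f k = (a • f) k
    have : g k ^ p - g k = algebraMap F E a := by
      simp only [g]
      rw [add_pow_char, ← map_pow, ZMod.pow_card, ← hc]
      ring
    rw [← sub_mul, this, Pi.smul_apply, Algebra.smul_def]
  · refine LinearMap.ext fun f => funext fun k => ?_
    rw [hj]
    change _ = (b • f) k
    rw [hd, Pi.smul_apply, Algebra.smul_def]
    simp
  · refine LinearMap.ext fun f => funext fun k => ?_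
    change d * (g (k - 1) * f (k - 1)) = g k * (d * f (k - 1)) - d * f (k - 1)
    simp only [g, map_sub, map_one]
    ring

namespace SymbolAlg

instance : Nontrivial (SymbolAlg p F a b) := by
  obtain ⟨d, hd⟩ := IsAlgClosed.exists_pow_nat_eq (algebraMap F (AlgebraicClosure F) b)
    (Fact.out : p.Prime).pos
  have hdeg : (Polynomial.X ^ p - Polynomial.X -
      Polynomial.C (algebraMap F (AlgebraicClosure F) a)).degree = (p : WithBot ℕ) := by
    rw [sub_sub, Polynomial.degree_sub_eq_left_of_degree_lt, Polynomial.degree_X_pow]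
    rw [Polynomial.degree_X_pow]
    refine (Polynomial.degree_add_le _ _).trans_lt (max_lt (Polynomial.degree_X_le.trans_lt ?_)
      (Polynomial.degree_C_le.trans_lt ?_))
    · exact_mod_cast (Fact.out : p.Prime).one_lt
    · exact_mod_cast (Fact.out : p.Prime).pos
  obtain ⟨c, hc⟩ := IsAlgClosed.exists_root _
    (hdeg.trans_ne (by exact_mod_cast (Fact.out : p.Prime).ne_zero))
  simp only [Polynomial.IsRoot, Polynomial.eval_sub, Polynomial.eval_pow, Polynomial.eval_X,
    Polynomial.eval_C, sub_eq_zero] at hc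
  obtain ⟨i, j, h⟩ := IsSymbolPair.exists_end hc hd
  exact (lift h).toRingHom.domain_nontrivial

instance : FiniteDimensional F (SymbolAlg p F a b) :=
  (isSymbolPair p F a b).finiteDimensional (adjoin_eq_top p F a b)

variable [NeZero b]

instance : IsSimpleRing (SymbolAlg p F a b) :=
  (isSymbolPair p F a b).isSimpleRing (NeZero.ne b) (adjoin_eq_top p F a b)

instance : Algebra.IsCentral F (SymbolAlg p F a b) :=
  (isSymbolPair p F a b).isCentral (NeZero.ne b) (adjoin_eq_top p F a b)

theorem finrank_eq : Module.finrank F (SymbolAlg p F a b) = p ^ 2 :=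
  (isSymbolPair p F a b).finrank_eq (NeZero.ne b) (adjoin_eq_top p F a b)

theorem isCyclicPAlg : IsCyclicPAlg p F (SymbolAlg p F a b) :=
  ⟨a, b, NeZero.ne b, finrank_eq, i p F a b, j p F a b, (isSymbolPair p F a b).i_pow,
    (isSymbolPair p F a b).j_pow, (isSymbolPair p F a b).rel, adjoin_eq_top p F a b⟩

end SymbolAlg

end SymbolAlgebra

section Symbol

variable (p : ℕ) {F : Type} [Field F] [Fact p.Prime] [CharP F p] (a b : F)

open Classical in
/-- The Brauer class of `[a, b)`, with the junk value `1` for `b = 0`. -/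
noncomputable def symb : BrauerGroup.{0, 0} F :=
  if h : b = 0 then 1 else haveI : NeZero b := ⟨h⟩; brauerClass F (SymbolAlg p F a b)

theorem symb_eq [NeZero b] : symb p a b = brauerClass F (SymbolAlg p F a b) :=
  dif_neg (NeZero.ne b)

@[simp]
theorem symb_zero_right : symb p a 0 = 1 := dif_pos rfl

variable {p a b}

theorem SymbolAlg.lift_mem {E : Type*} [Ring E] [Algebra F E] {i j : E}
    (h : IsSymbolPair p a b i j) (S : Subalgebra F E) (hi : i ∈ S) (hj : j ∈ S)
    (x : SymbolAlg p F a b) : SymbolAlg.lift h x ∈ S := by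
  have hx : x ∈ Algebra.adjoin F {SymbolAlg.i p F a b, SymbolAlg.j p F a b} :=
    SymbolAlg.adjoin_eq_top p F a b ▸ Algebra.mem_top
  have hle : Algebra.adjoin F {SymbolAlg.i p F a b, SymbolAlg.j p F a b} ≤
      S.comap (SymbolAlg.lift h) := by
    refine Algebra.adjoin_le ?_
    rintro _ (rfl | rfl)
    · simpa [SymbolAlg.lift_i] using hi
    · simpa [SymbolAlg.lift_j] using hj
  exact hle hx

theorem IsSymbolPair.brauerClass_eq_mul {A E : Type} [Ring A] [Algebra F A]
    [Algebra.IsCentral F A] [IsSimpleRing A] [FiniteDimensional F A] [Ring E] [Algebra F E]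
    [Algebra.IsCentral F E] [IsSimpleRing E] [FiniteDimensional F E] {i j : E}
    (h : IsSymbolPair p a b i j) (hb : b ≠ 0) (f : A →ₐ[F] E) (hi : ∀ x, Commute (f x) i)
    (hj : ∀ x, Commute (f x) j) (hdim : Module.finrank F A * p ^ 2 = Module.finrank F E) :
    brauerClass F E = brauerClass F A * symb p a b := by
  have : NeZero b := ⟨hb⟩
  rw [symb_eq]
  refine brauerClass_eq_mul_of_commute f (SymbolAlg.lift h) (fun x y => ?_)
    (by rw [SymbolAlg.finrank_eq, hdim])
  have := SymbolAlg.lift_mem h (Subalgebra.centralizer F {f x})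
    (by rw [Subalgebra.mem_centralizer_iff]; rintro _ rfl; exact hi x)
    (by rw [Subalgebra.mem_centralizer_iff]; rintro _ rfl; exact hj x) y
  rw [Subalgebra.mem_centralizer_iff] at this
  exact this _ rfl

theorem IsSymbolPair.brauerClass_eq {E : Type} [Ring E] [Algebra F E]
    [Algebra.IsCentral F E] [IsSimpleRing E] [FiniteDimensional F E] {i j : E}
    (h : IsSymbolPair p a b i j) (hb : b ≠ 0) (hdim : Module.finrank F E = p ^ 2) :
    brauerClass F E = symb p a b := by
  rw [h.brauerClass_eq_mul hb (Algebra.ofId F E) (fun x => Algebra.commutes x i)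
    (fun x => Algebra.commutes x j) (by simp [hdim]), brauerClass_self, one_mul]

theorem IsSymbolPair.brauerClass_eq_symb_mul {a' b' : F} {E : Type} [Ring E] [Algebra F E]
    [Algebra.IsCentral F E] [IsSimpleRing E] [FiniteDimensional F E] {i j i' j' : E}
    (h : IsSymbolPair p a b i j) (h' : IsSymbolPair p a' b' i' j') (hb : b ≠ 0) (hb' : b' ≠ 0)
    (hii : Commute i i') (hij : Commute i j') (hji : Commute j i') (hjj : Commute j j')
    (hdim : Module.finrank F E = p ^ 4) :
    brauerClass F E = symb p a b * symb p a' b' := by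
  have : NeZero b := ⟨hb⟩
  have hc {y : E} (hi : Commute i y) (hj : Commute j y) (x : SymbolAlg p F a b) :
      Commute (SymbolAlg.lift h x) y := by
    have := SymbolAlg.lift_mem h (Subalgebra.centralizer F {y})
      (by rw [Subalgebra.mem_centralizer_iff]; rintro _ rfl; exact hi.symm)
      (by rw [Subalgebra.mem_centralizer_iff]; rintro _ rfl; exact hj.symm) x
    rw [Subalgebra.mem_centralizer_iff] at this
    exact (this _ rfl).symm
  rw [h'.brauerClass_eq_mul hb' (SymbolAlg.lift h) (hc hii hji) (hc hij hjj)
    (by rw [SymbolAlg.finrank_eq, hdim]; ring), symb_eq p a b]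

theorem IsSymbolPair.symb_mul_symb_eq {a' b' : F} {E : Type} [Ring E] [Algebra F E]
    [Algebra.IsCentral F E] [IsSimpleRing E] [FiniteDimensional F E] {i j i' j' : E}
    (h : IsSymbolPair p a b i j) (h' : IsSymbolPair p a' b' i' j') (hb : b ≠ 0) (hb' : b' ≠ 0)
    (hii : Commute i i') (hij : Commute i j') (hji : Commute j i') (hjj : Commute j j')
    (hdim : Module.finrank F E = p ^ 4) :
    brauerClass F E = symb p (a + a') b * symb p a' (b' / b) := by
  have hp := (Fact.out : p.Prime)
  have : CharP E p := charP_of_injective_algebraMap (algebraMap F E).injective p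
  obtain ⟨u, rfl⟩ := h.isUnit hp.ne_zero hb
  have hu : i * ↑u⁻¹ = ↑u⁻¹ * (i - 1) := by
    rw [Units.mul_inv_eq_iff_eq_mul, mul_assoc, ← h.rel, Units.inv_mul_cancel_left]
  have hui : Commute (↑u⁻¹ : E) i' := hji.units_inv_left
  have huj : Commute (↑u⁻¹ : E) j' := hjj.units_inv_left
  refine IsSymbolPair.brauerClass_eq_symb_mul (i := i + i') (j := u) (i' := i') (j' := ↑u⁻¹ * j')
    ⟨?_, h.j_pow, ?_⟩ ⟨h'.i_pow, ?_, ?_⟩ hb (div_ne_zero hb' hb) (hii.add_left (.refl _)) ?_ hji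
    (.mul_right (Commute.refl _).units_inv_right hjj) hdim
  · rw [add_pow_char_of_commute _ hii, map_add, ← h.i_pow, ← h'.i_pow]
    abel
  · rw [mul_add, h.rel, hji.eq]
    noncomm_ring
  · have h1 : (↑u⁻¹ : E) ^ p = algebraMap F E b⁻¹ := by
      have h2 : (↑u⁻¹ : E) ^ p * (u : E) ^ p = 1 := by
        rw [← Units.val_pow_eq_pow_val, ← Units.val_pow_eq_pow_val, ← Units.val_mul, inv_pow,
          inv_mul_cancel, Units.val_one]
      rw [h.j_pow] at h2
      calc (↑u⁻¹ : E) ^ p = ↑u⁻¹ ^ p * (algebraMap F E b * algebraMap F E b⁻¹) := by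
            rw [← map_mul, mul_inv_cancel₀ hb, map_one, mul_one]
        _ = _ := by rw [← mul_assoc, h2, one_mul]
    rw [huj.mul_pow, h1, h'.j_pow, ← map_mul, div_eq_inv_mul]
  · rw [mul_assoc, h'.rel, ← mul_assoc, ← mul_assoc, mul_sub, mul_one, hui.eq, sub_mul, sub_mul,
      one_mul, sub_mul]
  · have h3 : i' * j' = j' * i' + j' := by rw [h'.rel]; noncomm_ring
    rw [Commute, SemiconjBy, add_mul, ← mul_assoc, hu, ← mul_assoc i', ← hui.eq, mul_assoc _ i',
      h3, mul_assoc _ (i - 1), sub_mul, hij.eq]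
    noncomm_ring

theorem symb_mul_symb {a' b' : F} (hb : b ≠ 0) (hb' : b' ≠ 0) :
    symb p a b * symb p a' b' = symb p (a + a') b * symb p a' (b' / b) := by
  have : NeZero b := ⟨hb⟩
  have : NeZero b' := ⟨hb'⟩
  rw [symb_eq p a b, symb_eq p a' b', ← brauerClass_tensor]
  refine IsSymbolPair.symb_mul_symb_eq
    ((SymbolAlg.isSymbolPair p F a b).map Algebra.TensorProduct.includeLeft)
    ((SymbolAlg.isSymbolPair p F a' b').map Algebra.TensorProduct.includeRight) hb hb' ?_ ?_ ?_ ?_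
    ?_
  · simp [Commute, SemiconjBy]
  · simp [Commute, SemiconjBy]
  · simp [Commute, SemiconjBy]
  · simp [Commute, SemiconjBy]
  · rw [Module.finrank_tensorProduct, SymbolAlg.finrank_eq, SymbolAlg.finrank_eq]
    ring

theorem Module.End.isSimpleRing (F V : Type*) [Field F] [AddCommGroup V] [Module F V]
    [FiniteDimensional F V] [Nontrivial V] : IsSimpleRing (Module.End F V) :=
  have : NeZero (Module.finrank F V) := ⟨Module.finrank_pos.ne'⟩
  .of_ringEquiv (algEquivMatrix (Module.finBasis F V)).symm.toRingEquiv inferInstance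

attribute [instance] Module.End.isSimpleRing

theorem symb_zero_one : symb p (0 : F) 1 = 1 := by
  have : NeZero p := ⟨(Fact.out : p.Prime).ne_zero⟩
  obtain ⟨i, j, h⟩ := IsSymbolPair.exists_end (p := p) (F := F) (a := 0) (b := 1) (E := F)
    (c := 0) (d := 1) (by simp [this.1]) (by simp)
  rw [← h.brauerClass_eq one_ne_zero (by
    rw [Module.finrank_linearMap, Module.finrank_fintype_fun_eq_card, ZMod.card, sq])]
  exact brauerClass_eq_one_of_algEquiv_end (V := ZMod p → F) AlgEquiv.refl

theorem symb_one_right : symb p a 1 = 1 := by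
  have h := symb_mul_symb (p := p) (a := 0) (b := (1 : F)) (a' := a) (b' := 1) one_ne_zero
    one_ne_zero
  rw [symb_zero_one, zero_add, div_one, one_mul] at h
  exact left_eq_mul.mp h

theorem symb_add (a a' b : F) : symb p (a + a') b = symb p a b * symb p a' b := by
  by_cases hb : b = 0
  · simp [hb]
  · rw [symb_mul_symb hb hb, div_self hb, symb_one_right, mul_one]

variable (p b) in
/-- The symbol as an additive character in its first argument. -/
noncomputable def symbHom : F →+ Additive (BrauerGroup.{0, 0} F) :=
  AddMonoidHom.mk' (fun a => Additive.ofMul (symb p a b)) fun a a' => symb_add a a' b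

theorem symb_zero_left : symb p 0 b = 1 := (symbHom p b).map_zero

theorem symb_neg : symb p (-a) b = (symb p a b)⁻¹ := (symbHom p b).map_neg a

theorem symb_sum {ι : Type*} (s : Finset ι) (f : ι → F) :
    symb p (∑ x ∈ s, f x) b = ∏ x ∈ s, symb p (f x) b := map_sum (symbHom p b) f s

theorem symb_div (hb : b ≠ 0) {b' : F} (hb' : b' ≠ 0) :
    symb p a (b' / b) = symb p a b' / symb p a b := by
  have h := symb_mul_symb (p := p) (a := 0) (a' := a) hb hb'
  rw [symb_zero_left, one_mul, zero_add] at h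
  rw [h, mul_div_cancel_left]

theorem symb_inv : symb p a b⁻¹ = (symb p a b)⁻¹ := by
  by_cases hb : b = 0
  · simp [hb]
  · rw [← one_div, symb_div hb one_ne_zero, symb_one_right, one_div]

theorem symb_mul (hb : b ≠ 0) {b' : F} (hb' : b' ≠ 0) :
    symb p a (b * b') = symb p a b * symb p a b' := by
  rw [← div_inv_eq_mul, symb_div (inv_ne_zero hb') hb, symb_inv, div_inv_eq_mul]

theorem symb_pow (n : ℕ) : symb p a (b ^ n) = symb p a b ^ n := by
  by_cases hb : b = 0
  · subst hb
    rcases Nat.eq_zero_or_pos n with rfl | hn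
    · simp [symb_one_right]
    · simp [hn.ne']
  induction n with
  | zero => simp [symb_one_right]
  | succ n ih => rw [pow_succ, pow_succ, symb_mul (pow_ne_zero n hb) hb, ih]

theorem symb_nsmul (n : ℕ) : symb p (n * a) b = symb p a b ^ n := by
  rw [← nsmul_eq_mul]
  exact (symbHom p b).map_nsmul n a

theorem symb_pow_card : symb p a b ^ p = 1 := by
  rw [← symb_nsmul, CharP.cast_eq_zero, zero_mul, symb_zero_left]

theorem symb_pow_card_right : symb p a (b ^ p) = 1 := by
  rw [symb_pow, symb_pow_card]

theorem symb_artinSchreier (u : F) : symb p (u ^ p - u) b = 1 := by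
  by_cases hb : b = 0
  · simp [hb]
  have : NeZero b := ⟨hb⟩
  have : CharP (SymbolAlg p F 0 b) p :=
    charP_of_injective_algebraMap (algebraMap F _).injective p
  have h := SymbolAlg.isSymbolPair p F 0 b
  have h2 : IsSymbolPair p (u ^ p - u) b (SymbolAlg.i p F 0 b + algebraMap F _ u)
      (SymbolAlg.j p F 0 b) := by
    refine ⟨?_, h.j_pow, ?_⟩
    · rw [add_pow_char_of_commute _ (Algebra.commutes u _).symm, map_sub, map_pow]
      have := h.i_pow
      rw [map_zero, sub_eq_zero] at this
      rw [this]
      abel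
    · rw [mul_add, h.rel, ← Algebra.commutes]
      noncomm_ring
  rw [← h2.brauerClass_eq hb SymbolAlg.finrank_eq, h.brauerClass_eq hb SymbolAlg.finrank_eq,
    symb_zero_left]

theorem symb_pow_left : symb p (a ^ p) b = symb p a b := by
  have := symb_add (p := p) (a ^ p - a) a b
  rwa [sub_add_cancel, symb_artinSchreier, one_mul] at this

theorem symb_self : symb p a a = 1 := by
  by_cases hb : a = 0
  · simp [hb]
  have : NeZero a := ⟨hb⟩
  let _ : Algebra (ZMod p) F := ZMod.algebra F p
  let _ : Algebra (ZMod p) (SymbolAlg p F 0 a) := Algebra.compHom _ (algebraMap (ZMod p) F)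
  have h := SymbolAlg.isSymbolPair p F 0 a
  have h2 : IsSymbolPair p a a (SymbolAlg.i p F 0 a + SymbolAlg.j p F 0 a)
      (SymbolAlg.j p F 0 a) := by
    refine ⟨?_, h.j_pow, ?_⟩
    · rw [add_pow_sub_of_commutator, h.i_pow, h.j_pow, map_zero, zero_add]
      rw [h.rel, sub_mul, one_mul, sub_add_cancel]
    · rw [mul_add, h.rel]
      noncomm_ring
  rw [← h2.brauerClass_eq hb SymbolAlg.finrank_eq, h.brauerClass_eq hb SymbolAlg.finrank_eq,
    symb_zero_left]

variable (p a b) in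
theorem BrauerGroup.res_symb (L : Type) [Field L] [Algebra F L] [CharP L p] :
    BrauerGroup.res F L (symb p a b) = symb p (algebraMap F L a) (algebraMap F L b) := by
  by_cases hb : b = 0
  · simp [hb]
  have : NeZero b := ⟨hb⟩
  rw [symb_eq, BrauerGroup.res_brauerClass]
  have h := SymbolAlg.isSymbolPair p F a b
  have h2 : IsSymbolPair p (algebraMap F L a) (algebraMap F L b)
      ((1 : L) ⊗ₜ[F] SymbolAlg.i p F a b) ((1 : L) ⊗ₜ[F] SymbolAlg.j p F a b) := by
    have hm (c : F) : algebraMap L (L ⊗[F] SymbolAlg p F a b) (algebraMap F L c) =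
        (1 : L) ⊗ₜ[F] algebraMap F _ c := by
      rw [← IsScalarTower.algebraMap_apply]
      exact (AlgHom.commutes Algebra.TensorProduct.includeRight c).symm
    have hf (x y : SymbolAlg p F a b) : (1 : L) ⊗ₜ[F] x - (1 : L) ⊗ₜ[F] y = 1 ⊗ₜ (x - y) :=
      (TensorProduct.tmul_sub _ _ _).symm
    refine ⟨?_, ?_, ?_⟩
    · rw [Algebra.TensorProduct.tmul_pow, one_pow, hf, h.i_pow, hm]
    · rw [Algebra.TensorProduct.tmul_pow, one_pow, h.j_pow, hm]
    · rw [Algebra.TensorProduct.one_def, hf, Algebra.TensorProduct.tmul_mul_tmul,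
        Algebra.TensorProduct.tmul_mul_tmul, h.rel]
  refine h2.brauerClass_eq ?_ ?_
  · simpa using hb
  · rw [Module.finrank_baseChange, SymbolAlg.finrank_eq]

end Symbol

section SymbolIdentities

variable {p : ℕ} {F : Type} [Field F] [Fact p.Prime] [CharP F p] {a b : F}

theorem symb_mul_self (d s : F) : symb p (d * s) s = symb p (d * s) d⁻¹ := by
  by_cases hd : d = 0
  · simp [hd, symb_zero_left]
  by_cases hs : s = 0
  · simp [hs, symb_zero_left]
  have h : symb p (d * s) (d * s) = 1 := symb_self
  rw [symb_mul hd hs] at h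
  rw [symb_inv, eq_inv_iff_mul_eq_one, mul_comm, h]

/-- Expansion of a symbol whose second argument is a sum. -/
theorem symb_sum_right {ι : Type*} (s : Finset ι) (f : ι → F) (a : F) (h : ∑ x ∈ s, f x ≠ 0) :
    symb p a (∑ x ∈ s, f x) = ∏ x ∈ s, symb p (a / (∑ x ∈ s, f x) * f x) (f x) := by
  set d := a / ∑ x ∈ s, f x with hd
  have ha : a = d * ∑ x ∈ s, f x := by rw [hd, div_mul_cancel₀ _ h]
  rw [ha, symb_mul_self, Finset.mul_sum, symb_sum]
  exact Finset.prod_congr rfl fun x _ => (symb_mul_self d (f x)).symm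

theorem exists_symb_mul_pow_eq (v b : F) {k : ℕ} (hk : 0 < k) (hkp : k < p) :
    ∃ m : ℕ, symb p (v * b ^ k) b = symb p (m * (v * b ^ k)) v := by
  have hp := (Fact.out : p.Prime)
  by_cases hv : v = 0
  · exact ⟨0, by simp [hv, symb_zero_left]⟩
  by_cases hb : b = 0
  · exact ⟨0, by simp [hb, hk.ne', symb_zero_left]⟩
  have h : symb p (v * b ^ k) (v * b ^ k) = 1 := symb_self
  rw [symb_mul hv (pow_ne_zero k hb), symb_pow] at h
  have ht : symb p (v * b ^ k) b ^ p = 1 := symb_pow_card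
  obtain ⟨m, hm⟩ : ∃ m : ℕ, p ∣ k * m + 1 := by
    have hk0 : (k : ZMod p) ≠ 0 := by
      rw [Ne, ZMod.natCast_eq_zero_iff]
      exact Nat.not_dvd_of_pos_of_lt hk hkp
    refine ⟨(-(k : ZMod p)⁻¹).val, ?_⟩
    rw [← ZMod.natCast_eq_zero_iff]
    push_cast
    rw [ZMod.natCast_zmod_val, mul_neg, mul_inv_cancel₀ hk0]
    ring
  obtain ⟨q, hq⟩ := hm
  refine ⟨m, ?_⟩
  rw [symb_nsmul]
  have h1 : symb p (v * b ^ k) v ^ m * symb p (v * b ^ k) b ^ (k * m) = 1 := by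
    rw [pow_mul, ← mul_pow, h, one_pow]
  have h2 : symb p (v * b ^ k) b * symb p (v * b ^ k) b ^ (k * m) = 1 := by
    rw [← pow_succ', hq, pow_mul, ht, one_pow]
  exact mul_right_cancel (h2.trans h1.symm)

theorem brauerClass_eq_symb_of_isCyclicPAlg {D : Type} [Ring D] [Algebra F D]
    (h : IsCyclicPAlg p F D) :
    ∃ (_ : Algebra.IsCentral F D) (_ : IsSimpleRing D) (_ : FiniteDimensional F D) (a b : F),
      b ≠ 0 ∧ brauerClass F D = symb p a b := by
  obtain ⟨a, b, hb, hdim, i, j, hi, hj, hr, hadj⟩ := h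
  have hpair : IsSymbolPair p a b i j := ⟨hi, hj, hr⟩
  have : Nontrivial D := Module.nontrivial_of_finrank_pos (R := F)
    (hdim ▸ pow_pos (Fact.out : p.Prime).pos 2)
  have h1 := hpair.isCentral hb hadj
  have h2 := hpair.isSimpleRing hb hadj
  have h3 := hpair.finiteDimensional hadj
  exact ⟨h1, h2, h3, a, b, hb, hpair.brauerClass_eq hb hdim⟩

theorem brauerClass_eq_prod_of_symbolLengthLE {A : Type} [Ring A] [Algebra F A]
    [Algebra.IsCentral F A] [IsSimpleRing A] [FiniteDimensional F A] {m : ℕ}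
    (h : SymbolLengthLE p F A m) :
    ∃ k ≤ m, ∃ a b : Fin k → F, (∀ t, b t ≠ 0) ∧
      brauerClass F A = ∏ t, symb p (a t) (b t) := by
  obtain ⟨k, hk, D, _, _, hD, hA⟩ := h
  choose h1 h2 h3 a b hb hab using fun t => brauerClass_eq_symb_of_isCyclicPAlg (hD t)
  obtain ⟨h4, h5, h6, h7⟩ := brauerClass_piTensorProduct (F := F) D
  refine ⟨k, hk, a, b, hb, ?_⟩
  rw [brauerClass_eq_iff.mpr hA, h7]
  exact Finset.prod_congr rfl fun t _ => hab t

theorem symbolLengthLE_of_brauerClass_eq_prod {A : Type} [Ring A] [Algebra F A]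
    [Algebra.IsCentral F A] [IsSimpleRing A] [FiniteDimensional F A] {ι : Type*} [Fintype ι]
    {m : ℕ} (hm : Fintype.card ι ≤ m) (a b : ι → F)
    (h : brauerClass F A = ∏ t, symb p (a t) (b t)) : SymbolLengthLE p F A m := by
  classical
  obtain ⟨e⟩ : Nonempty (Fin (Fintype.card ι) ≃ ι) := ⟨(Fintype.equivFin ι).symm⟩
  let a' : Fin (Fintype.card ι) → F := fun t => a (e t)
  let b' : Fin (Fintype.card ι) → F := fun t => if b (e t) = 0 then 1 else b (e t)
  have hb' (t) : NeZero (b' t) := ⟨by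
    simp only [b']
    split_ifs with h0
    exacts [one_ne_zero, h0]⟩
  have hs (t) : symb p (a' t) (b' t) = symb p (a (e t)) (b (e t)) := by
    simp only [a', b']
    split_ifs with h0
    · rw [h0, symb_zero_right, symb_one_right]
    · rfl
  let D : Fin (Fintype.card ι) → Type := fun t => SymbolAlg p F (a' t) (b' t)
  obtain ⟨h4, h5, h6, h7⟩ := brauerClass_piTensorProduct (F := F) D
  refine ⟨_, hm, D, inferInstance, inferInstance, fun t => SymbolAlg.isCyclicPAlg, ?_⟩
  rw [← brauerClass_eq_iff, h, h7, ← e.prod_comp]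
  exact Finset.prod_congr rfl fun t _ => (hs t).symm.trans (symb_eq p _ _)

end SymbolIdentities

section Derivation

variable {p : ℕ} [Fact p.Prime] {F K : Type*} [Field F] [CharP F p] [Field K] [Algebra F K]
  {β : K} {b : F}

/-- The derivation `β d/dβ` of a purely inseparable extension `K = F(β)` of degree `p`. -/
theorem exists_derivation (hβ : β ^ p = algebraMap F K b) (B : Module.Basis (Fin p) F K)
    (hB : ∀ k, B k = β ^ (k : ℕ)) :
    ∃ d : K →ₗ[F] K, (∀ x y, d (x * y) = d x * y + x * d y) ∧ d β = β ∧
      ∀ x, d x = 0 → x ∈ (algebraMap F K).range := by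
  have hp := (Fact.out : p.Prime)
  let d : K →ₗ[F] K := B.constr F fun k => ((k : ℕ) : F) • β ^ (k : ℕ)
  have hdB (k : Fin p) : d (B k) = ((k : ℕ) : F) • β ^ (k : ℕ) := B.constr_basis _ _ _
  have hd (n : ℕ) : d (β ^ n) = (n : F) • β ^ n := by
    have h1 : β ^ n = b ^ (n / p) • β ^ (n % p) := by
      conv_lhs => rw [← Nat.div_add_mod n p, pow_add, pow_mul, hβ, ← map_pow]
      rw [Algebra.smul_def]
    have h2 := hdB ⟨n % p, Nat.mod_lt _ hp.pos⟩
    rw [hB] at h2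
    have h3 : ((n % p : ℕ) : F) = n := by
      conv_rhs => rw [← Nat.mod_add_div n p]
      simp
    rw [h1, map_smul, h2, h3, smul_comm]
  have hmul (x y : K) : d (x * y) = d x * y + x * d y := by
    have : (LinearMap.mul F K).compr₂ d =
        (LinearMap.mul F K).comp d + (LinearMap.mul F K).compl₂ d := by
      refine LinearMap.ext_basis B B fun k l => ?_
      simp only [LinearMap.compr₂_apply, LinearMap.add_apply, LinearMap.comp_apply,
        LinearMap.compl₂_apply, LinearMap.mul_apply', hB, hd, ← pow_add]
      rw [Nat.cast_add, add_smul, smul_mul_assoc, mul_smul_comm, ← pow_add]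
    exact congr($this x y)
  refine ⟨d, hmul, by simpa using hd 1, fun x hx => ?_⟩
  have h0 : d x = ∑ k : Fin p, (((k : ℕ) : F) * B.repr x k) • B k := by
    conv_lhs => rw [← B.sum_repr x, map_sum]
    refine Finset.sum_congr rfl fun k _ => ?_
    rw [map_smul, hdB, ← hB, smul_smul, mul_comm]
  rw [h0] at hx
  have h1 := Fintype.linearIndependent_iff.mp B.linearIndependent _ hx
  refine ⟨B.repr x ⟨0, hp.pos⟩, ?_⟩
  conv_rhs => rw [← B.sum_repr x]
  rw [Finset.sum_eq_single ⟨0, hp.pos⟩]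
  · simp [hB, Algebra.smul_def]
  · intro k _ hk
    have := (mul_eq_zero.mp (h1 k)).resolve_left fun h => hk (Fin.ext ?_)
    · simp [this]
    · rw [CharP.cast_eq_zero_iff F p] at h
      exact Nat.eq_zero_of_dvd_of_lt h k.2
  · simp

end Derivation

section Kernel

variable {p : ℕ} [Fact p.Prime] {F K : Type} [Field F] [CharP F p] [Field K] [Algebra F K]
  {β : K} {b : F} {A : Type} [Ring A] [Algebra F A]

/-- A derivation of the base lifts to a semilinear operator commuting with `A` on any module
splitting `A`. -/
theorem exists_connection (d : K →ₗ[F] K) (hd : ∀ x y, d (x * y) = d x * y + x * d y) {V : Type}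
    [AddCommGroup V] [Module K V] [Module F V] [IsScalarTower F K V] [Nontrivial V]
    (e : (K ⊗[F] A) ≃ₐ[K] Module.End K V) :
    ∃ D : Module.End F V, (∀ (c : K) v, D (c • v) = d c • v + c • D v) ∧
      ∀ (a : A) v, D (e (1 ⊗ₜ a) v) = e (1 ⊗ₜ a) (D v) := by
  obtain ⟨v₀, hv₀⟩ := exists_ne (0 : V)
  obtain ⟨f, hf⟩ := Module.Projective.exists_dual_eq_one K hv₀
  let Δ : K ⊗[F] A →ₗ[F] K ⊗[F] A := d.rTensor A
  have hΔ (c : K) (y : K ⊗[F] A) : Δ (c • y) = d c • y + c • Δ y := by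
    induction y with
    | zero => simp
    | tmul x a => simp [Δ, TensorProduct.smul_tmul', hd, TensorProduct.add_tmul]
    | add y z hy hz =>
      rw [smul_add, map_add, hy, hz, map_add, smul_add, smul_add]
      abel
  have hΔA (a : A) (y : K ⊗[F] A) : Δ ((1 ⊗ₜ a) * y) = (1 ⊗ₜ a) * Δ y := by
    induction y with
    | zero => simp
    | tmul x a => simp [Δ]
    | add y z hy hz => rw [mul_add, map_add, hy, hz, map_add, mul_add]
  let r (v : V) : K ⊗[F] A := e.symm (f.smulRight v)
  have hr_add (v w : V) : r (v + w) = r v + r w := by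
    rw [← map_add]
    refine congrArg e.symm (LinearMap.ext fun x => ?_)
    simp
  have hr_smul (c : K) (v : V) : r (c • v) = c • r v := by
    rw [← map_smul]
    refine congrArg e.symm (LinearMap.ext fun x => ?_)
    simp [smul_comm c]
  have hrA (a : A) (v : V) : r (e (1 ⊗ₜ a) v) = (1 ⊗ₜ a) * r v := by
    apply e.injective
    rw [map_mul, e.apply_symm_apply, e.apply_symm_apply]
    ext x
    simp
  have hr (v : V) : e (r v) v₀ = v := by
    rw [e.apply_symm_apply]
    simp [hf]
  have hD (c : K) (v : V) : e (Δ (r (c • v))) v₀ = d c • v + c • e (Δ (r v)) v₀ := by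
    rw [hr_smul, hΔ, map_add, map_smul, map_smul, LinearMap.add_apply, LinearMap.smul_apply,
      LinearMap.smul_apply, hr]
  have hd1 : d 1 = 0 := by simpa using hd 1 1
  refine ⟨{ toFun := fun v => e (Δ (r v)) v₀, map_add' := ?_, map_smul' := ?_ }, hD, ?_⟩
  · intro v w
    rw [hr_add, map_add, map_add, LinearMap.add_apply]
  · intro c v
    rw [← IsScalarTower.algebraMap_smul K c v, hD, Algebra.algebraMap_eq_smul_one, map_smul, hd1,
      smul_zero, zero_smul, zero_add, RingHom.id_apply, smul_assoc, one_smul]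
  · intro a v
    change e (Δ (r (e (1 ⊗ₜ a) v))) v₀ = e (1 ⊗ₜ a) (e (Δ (r v)) v₀)
    rw [hrA, hΔA, map_mul, Module.End.mul_apply]

/-- The relative Brauer group of a purely inseparable extension of degree `p` consists of
symbols. -/
theorem exists_brauerClass_eq_symb [CharP K p] [Algebra.IsCentral F A] [IsSimpleRing A]
    [FiniteDimensional F A] (hb : b ≠ 0) (hβ : β ^ p = algebraMap F K b)
    (B : Module.Basis (Fin p) F K) (hB : ∀ k, B k = β ^ (k : ℕ))
    (h : BrauerGroup.res F K (brauerClass F A) = 1) : ∃ z : F, brauerClass F A = symb p z b := by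
  have hp := (Fact.out : p.Prime)
  rw [BrauerGroup.res_brauerClass] at h
  obtain ⟨V, _, _, _, _, ⟨e⟩⟩ := exists_algEquiv_end_of_brauerClass_eq_one h
  let _ : Module F V := Module.compHom V (algebraMap F K)
  have : IsScalarTower F K V := ⟨fun x y z => by
    rw [Algebra.smul_def, mul_smul]
    rfl⟩
  have hfinK : FiniteDimensional F K := B.finiteDimensional_of_finite
  have : FiniteDimensional F V := FiniteDimensional.trans F K V
  obtain ⟨d, hd, hdβ, hconst⟩ := exists_derivation hβ B hB
  obtain ⟨D, hD, hDA⟩ := exists_connection d hd e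
  let j : Module.End F V := Algebra.lsmul F F V β
  have hj (v : V) : j v = β • v := rfl
  have hrel : j * D = (D - 1) * j := by
    ext v
    simp [hj, hD, hdβ]
  have hjp : j ^ p = algebraMap F _ b := by
    rw [← map_pow, hβ]
    ext v
    simp
  have : CharP (Module.End F V) p :=
    charP_of_injective_algebraMap (algebraMap F (Module.End F V)).injective p
  have hcj : Commute (D ^ p - D) j := by
    refine commute_pow_sub_of_commutator ?_
    rw [hrel, sub_mul, one_mul, sub_add_cancel]
  have hcA (x : A) : Commute (D ^ p - D)
      ((e (1 ⊗ₜ x)).restrictScalars F : Module.End F V) := by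
    have : Commute D ((e (1 ⊗ₜ x)).restrictScalars F : Module.End F V) := by
      ext v
      simp [hDA]
    exact (this.pow_left p).sub_left this
  have hcK (c : K) (v : V) : (D ^ p - D) (c • v) = c • (D ^ p - D) v := by
    induction B.mem_span c using Submodule.span_induction with
    | mem c hc =>
      obtain ⟨k, rfl⟩ := hc
      have hjk (w : V) : (j ^ (k : ℕ)) w = β ^ (k : ℕ) • w := by
        rw [← map_pow]
        rfl
      rw [hB, ← hjk, ← hjk]
      exact congr($((hcj.pow_right (k : ℕ)).eq) v)
    | zero => simp
    | add x y _ _ hx hy => rw [add_smul, map_add, hx, hy, add_smul]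
    | smul r x _ hx => rw [smul_assoc, map_smul, hx, smul_assoc]
  let Z : Module.End K V :=
    { toFun := (D ^ p - D : Module.End F V), map_add' := map_add _, map_smul' := hcK }
  obtain ⟨z, hz⟩ : ∃ z : K, Z = algebraMap K _ z := by
    have hZ : Z ∈ Subalgebra.center K (Module.End K V) := by
      rw [Subalgebra.mem_center_iff]
      intro y
      obtain ⟨y, rfl⟩ := e.surjective y
      induction y with
      | zero => simp
      | tmul c x =>
        have h1 : c ⊗ₜ[F] x = c • (1 ⊗ₜ[F] x) := by simp [TensorProduct.smul_tmul']
        have h2 : e (1 ⊗ₜ[F] x) * Z = Z * e (1 ⊗ₜ[F] x) :=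
          LinearMap.ext fun v => congr($((hcA x).eq.symm) v)
        rw [h1, map_smul, smul_mul_assoc, mul_smul_comm, h2]
      | add y z hy hz => rw [map_add, add_mul, mul_add, hy, hz]
    obtain ⟨z, hz⟩ := Algebra.IsCentral.out hZ
    exact ⟨z, hz.symm⟩
  have hzv (v : V) : (D ^ p - D) v = z • v := congr($hz v)
  obtain ⟨w, rfl⟩ : z ∈ (algebraMap F K).range := by
    refine hconst z ?_
    obtain ⟨v, hv⟩ := exists_ne (0 : V)
    have h1 : Commute (D ^ p - D) D := ((Commute.refl D).pow_left p).sub_left (.refl D)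
    have h2 := congr($(h1.eq) v)
    rw [Module.End.mul_apply, Module.End.mul_apply, hzv, hzv, hD, right_eq_add] at h2
    exact (smul_eq_zero.mp h2).resolve_right hv
  have hpair : IsSymbolPair p w b D j := by
    refine ⟨?_, hjp, hrel⟩
    ext v
    rw [hzv]
    simp
  let f : A →ₐ[F] Module.End F V :=
    { toFun := fun x => (e (1 ⊗ₜ x)).restrictScalars F
      map_one' := by rw [← Algebra.TensorProduct.one_def, map_one]; rfl
      map_mul' := fun x y => by
        rw [show (1 : K) ⊗ₜ[F] (x * y) = 1 ⊗ₜ x * 1 ⊗ₜ y by simp, map_mul]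
        rfl
      map_zero' := by rw [TensorProduct.tmul_zero, map_zero]; rfl
      map_add' := fun x y => by rw [TensorProduct.tmul_add, map_add]; rfl
      commutes' := fun c => by
        rw [Algebra.algebraMap_eq_smul_one, TensorProduct.tmul_smul,
          ← Algebra.TensorProduct.one_def, ← IsScalarTower.algebraMap_smul K c, map_smul, map_one]
        ext v
        simp }
  have hfr : Module.finrank F A * p ^ 2 = Module.finrank F (Module.End F V) := by
    have h1 : Module.finrank F A = Module.finrank K V ^ 2 := by
      rw [← Module.finrank_baseChange (R := K), e.toLinearEquiv.finrank_eq,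
        Module.finrank_linearMap, sq]
    rw [h1, Module.finrank_linearMap, ← Module.finrank_mul_finrank F K V,
      Module.finrank_eq_card_basis B, Fintype.card_fin]
    ring
  have h1 := hpair.brauerClass_eq_mul hb f (fun x => ?_) (fun x => ?_) hfr
  · rw [brauerClass_eq_one_of_algEquiv_end (V := V) AlgEquiv.refl] at h1
    exact ⟨-w, by rw [symb_neg, eq_inv_iff_mul_eq_one, h1]⟩
  · ext v
    simp [f, hDA]
  · ext v
    simp [f, hj]

end Kernel

section SplitSymbol

open Polynomial

variable {p : ℕ} [Fact p.Prime] {F : Type} [Field F] [CharP F p] {a b : F}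

theorem add_sum_pow_sub {D : Type*} [Ring D] [Algebra F D] {d j : D} (hd : d ^ p - d = 0)
    (hj : j ^ p = algebraMap F D b) (h : d * j = j * d + j) (g : ℕ → F) {n : ℕ} (hn : n < p) :
    (d + ∑ k ∈ Finset.range (n + 1), g k • j ^ k) ^ p -
      (d + ∑ k ∈ Finset.range (n + 1), g k • j ^ k) =
      algebraMap F D (g 0 ^ p - g 0 + ∑ k ∈ Finset.range n, g (k + 1) ^ p * b ^ (k + 1)) := by
  let _ : Algebra (ZMod p) F := ZMod.algebra F p
  let _ : Algebra (ZMod p) D := Algebra.compHom _ (algebraMap (ZMod p) F)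
  nontriviality D
  have : CharP D p := charP_of_injective_algebraMap (algebraMap F D).injective p
  induction n with
  | zero =>
    have hc : Commute d (algebraMap F D (g 0)) := (Algebra.commutes _ _).symm
    simp only [zero_add, Finset.range_one, Finset.sum_singleton, pow_zero, Finset.range_zero,
      Finset.sum_empty, add_zero, ← Algebra.algebraMap_eq_smul_one]
    rw [add_pow_char_of_commute _ hc, map_sub, map_pow, add_sub_add_comm, hd, zero_add]
  | succ n ih =>
    rw [Finset.sum_range_succ, ← add_assoc,
      add_pow_sub_of_commutator_smul (((n + 1 : ℕ)) : ZMod p), ih (by omega),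
      Finset.sum_range_succ, ← add_assoc, _root_.smul_pow, ← pow_mul, mul_comm (n + 1) p,
      pow_mul, hj, ← map_pow, Algebra.smul_def, ← map_mul, ← map_add]
    · rw [Ne, ZMod.natCast_eq_zero_iff]
      exact Nat.not_dvd_of_pos_of_lt n.succ_pos hn
    · set S := ∑ k ∈ Finset.range (n + 1), g k • j ^ k with hS
      have hSj : Commute S j := by
        refine Commute.sum_left _ _ _ fun k _ => ?_
        exact ((Commute.refl j).pow_left k).smul_left (g k)
      have h1 : (d + S) * j = j * (d + S) + j := by
        rw [add_mul, h, hSj.eq, mul_add]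
        abel
      have h2 := mul_pow_of_commutator h1 (n + 1)
      have h3 : (((n + 1 : ℕ)) : ZMod p) • (g (n + 1) • j ^ (n + 1)) =
          g (n + 1) • (((n + 1 : ℕ) : D) * j ^ (n + 1)) := by
        rw [Algebra.smul_def, map_natCast, mul_smul_comm]
      rw [h3, mul_smul_comm, h2, smul_add, smul_mul_assoc]

theorem exists_eq_of_symb_eq_one (hb : ∀ x : F, x ^ p ≠ b) (h : symb p a b = 1) :
    ∃ g : ℕ → F, a = g 0 ^ p - g 0 + ∑ k ∈ Finset.range (p - 1), g (k + 1) ^ p * b ^ (k + 1) := by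
  have hp := (Fact.out : p.Prime)
  have hb0 : NeZero b := ⟨fun h0 => hb 0 (by simp [h0, hp.ne_zero])⟩
  rw [symb_eq] at h
  obtain ⟨V, _, _, _, _, ⟨e⟩⟩ := exists_algEquiv_end_of_brauerClass_eq_one h
  have hpair := (SymbolAlg.isSymbolPair p F a b).map e.toAlgHom
  set i : Module.End F V := e.toAlgHom (SymbolAlg.i p F a b)
  set j : Module.End F V := e.toAlgHom (SymbolAlg.j p F a b)
  have hV : Module.finrank F V = p := by
    have h1 := e.toLinearEquiv.finrank_eq
    rw [SymbolAlg.finrank_eq, Module.finrank_linearMap, ← sq] at h1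
    exact (Nat.pow_left_injective two_ne_zero h1).symm
  have : CharP (Module.End F V) p :=
    charP_of_injective_algebraMap (algebraMap F (Module.End F V)).injective p
  obtain ⟨v, hv⟩ := exists_ne (0 : V)
  have hirr : Irreducible (X ^ p - C b) := X_pow_sub_C_irreducible_of_prime hp hb
  let ev : degreeLT F p →ₗ[F] V :=
    (LinearMap.applyₗ v ∘ₗ (aeval j).toLinearMap) ∘ₗ (degreeLT F p).subtype
  have hev (f : degreeLT F p) : ev f = aeval j (f : F[X]) v := rfl
  have hinj : Function.Injective ev := by
    rw [injective_iff_map_eq_zero]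
    intro f hf
    by_contra hne
    have hne' : (f : F[X]) ≠ 0 := fun h0 => hne (Subtype.ext h0)
    have hdeg : (f : F[X]).degree < (X ^ p - C b).degree := by
      rw [degree_X_pow_sub_C hp.pos]
      exact mem_degreeLT.mp f.2
    obtain ⟨t, s, hst⟩ := hirr.coprime_iff_not_dvd.mpr
      fun hdvd => (degree_le_of_dvd hdvd hne').not_gt hdeg
    have := congr(aeval j $hst v)
    simp [hpair.j_pow] at this
    rw [hev] at hf
    rw [hf, map_zero] at this
    exact hv this.symm
  have hsurj : Function.Surjective ev := by
    have : FiniteDimensional F (degreeLT F p) := (degreeLTEquiv F p).symm.finiteDimensional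
    refine (LinearMap.injective_iff_surjective_of_finrank_eq_finrank ?_).mp hinj
    rw [(degreeLTEquiv F p).finrank_eq, hV, Module.finrank_fin_fun]
  obtain ⟨g, hg⟩ := hsurj (i v)
  rw [hev] at hg
  have hij : i * j = j * i + j := by rw [hpair.rel, sub_mul, one_mul, sub_add_cancel]
  have hcg (f : F[X]) : Commute j (aeval j f) := by
    have := congrArg (aeval j) (mul_comm X f)
    rwa [map_mul, map_mul, aeval_X] at this
  set d := i - aeval j (g : F[X]) with hd
  have hdj : d * j = j * d + j := by
    rw [hd, sub_mul, hij, ← (hcg _).eq, mul_sub]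
    abel
  have hdv : d v = 0 := by rw [hd, LinearMap.sub_apply, hg, sub_self]
  have hd0 : d ^ p - d = 0 := by
    ext w
    obtain ⟨f, rfl⟩ := hsurj w
    have hc : Commute (d ^ p - d) (aeval j (f : F[X])) := by
      have := commute_pow_sub_of_commutator hdj
      induction (f : F[X]) using Polynomial.induction_on' with
      | add f g hf hg => simpa using hf.add_right hg
      | monomial n r =>
        rw [aeval_monomial]
        exact (Algebra.commute_algebraMap_right r _).mul_right (this.pow_right n)
    have h1 : (d ^ p - d) v = 0 := by
      obtain ⟨q, hq⟩ := Nat.exists_eq_succ_of_ne_zero hp.ne_zero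
      have : (d ^ p) v = 0 := by rw [hq, pow_succ, Module.End.mul_apply, hdv, map_zero]
      rw [LinearMap.sub_apply, this, hdv, sub_zero]
    rw [hev, ← Module.End.mul_apply, hc.eq, Module.End.mul_apply, h1, map_zero]
    rfl
  refine ⟨(g : F[X]).coeff, (algebraMap F (Module.End F V)).injective ?_⟩
  rw [← hpair.i_pow, ← add_sum_pow_sub hd0 hpair.j_pow hdj _ (Nat.sub_lt hp.pos one_pos),
    Nat.sub_add_cancel hp.one_le]
  have h2 : aeval j (g : F[X]) = ∑ k ∈ Finset.range p, (g : F[X]).coeff k • j ^ k := by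
    refine aeval_eq_sum_range' ?_ j
    rcases eq_or_ne (g : F[X]) 0 with h0 | h0
    · rw [h0, natDegree_zero]
      exact hp.pos
    · exact (natDegree_lt_iff_degree_lt h0).mpr (mem_degreeLT.mp g.2)
  rw [← h2, hd, sub_add_cancel]

end SplitSymbol

section Corner

open Polynomial

/-- The identity of a finite-dimensional space decomposes into idempotents commuting with a given
endomorphism `s`, whose corners in the centralizer of `s` consist of polynomials in `s`. -/
theorem Module.End.exists_idempotents_commute {F : Type} [Field F] {W : Type} [AddCommGroup W]
    [Module F W] [FiniteDimensional F W] (s : Module.End F W) :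
    ∃ (ι : Type) (_ : Fintype ι) (e : ι → Module.End F W), (∀ i, Commute s (e i)) ∧
      (∀ i, e i * e i = e i) ∧ ∑ i, e i = 1 ∧
      ∀ i x, Commute s x → ∃ g : F[X], e i * x * e i = aeval s g * e i := by
  classical
  obtain ⟨ι, _, q, -, k, ⟨Φ⟩⟩ := Module.equiv_directSum_of_isTorsion (R := F[X])
    (M := Module.AEval F W s) (Module.AEval.isTorsion_of_finiteDimensional F W s)
  let o := Module.AEval.of F W s
  let ε (i : ι) : Module.End F[X] (Module.AEval F W s) :=
    Φ.symm.toLinearMap ∘ₗ DirectSum.lof F[X] ι (fun i => F[X] ⧸ F[X] ∙ q i ^ k i) i ∘ₗ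
      DirectSum.component F[X] ι (fun i => F[X] ⧸ F[X] ∙ q i ^ k i) i ∘ₗ Φ.toLinearMap
  have hε (i : ι) : ε i * ε i = ε i := by
    refine LinearMap.ext fun v => ?_
    simp [ε]
  have hsum : ∑ i, ε i = 1 := by
    refine LinearMap.ext fun v => ?_
    apply Φ.injective
    simp only [ε, LinearMap.sum_apply, map_sum, LinearMap.comp_apply, LinearEquiv.coe_coe,
      LinearEquiv.apply_symm_apply, Module.End.one_apply]
    refine DirectSum.ext_component F[X] fun j => ?_
    rw [map_sum, Finset.sum_eq_single j, DirectSum.component.lof_self]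
    · intro i _ hij
      rw [DirectSum.component.of, dif_neg hij]
    · simp
  let down (f : Module.End F[X] (Module.AEval F W s)) : Module.End F W :=
    o.symm.toLinearMap ∘ₗ f.restrictScalars F ∘ₗ o.toLinearMap
  have down_apply f v : down f v = o.symm (f (o v)) := rfl
  have hX (g : F[X]) (v : W) : o (aeval s g v) = g • o v := Module.AEval.of_aeval_smul s g v
  refine ⟨ι, inferInstance, fun i => down (ε i), fun i => ?_, fun i => ?_, ?_, fun i x hx => ?_⟩
  · refine LinearMap.ext fun v => o.injective ?_
    have h1 (v : W) : o (s v) = (X : F[X]) • o v := by simpa using hX X v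
    simp [down_apply, h1]
  · refine LinearMap.ext fun v => o.injective ?_
    simpa [down_apply] using congr($(hε i) (o v))
  · refine LinearMap.ext fun v => o.injective ?_
    simpa [down_apply] using congr($hsum (o v))
  · have hxg (g : F[X]) (v : W) : x (aeval s g v) = aeval s g (x v) := by
      have : Commute (aeval s g) x := by
        induction g using Polynomial.induction_on' with
        | add f g hf hg => simpa using hf.add_left hg
        | monomial n r =>
          rw [aeval_monomial]
          exact (Algebra.commute_algebraMap_left r _).mul_left (hx.pow_left n)
      exact congr($this.symm.eq v)
    let ξ : Module.End F[X] (Module.AEval F W s) :=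
      { toFun v := o (x (o.symm v))
        map_add' v w := by simp
        map_smul' g v := by
          obtain ⟨v, rfl⟩ := o.surjective v
          rw [← hX, o.symm_apply_apply, hxg, hX, o.symm_apply_apply]
          rfl }
    let f : Module.End F[X] (F[X] ⧸ F[X] ∙ q i ^ k i) :=
      DirectSum.component F[X] ι (fun i => F[X] ⧸ F[X] ∙ q i ^ k i) i ∘ₗ Φ.toLinearMap ∘ₗ ξ ∘ₗ
        Φ.symm.toLinearMap ∘ₗ DirectSum.lof F[X] ι (fun i => F[X] ⧸ F[X] ∙ q i ^ k i) i
    obtain ⟨g, hg⟩ := Submodule.mkQ_surjective _ (f (Submodule.mkQ _ 1))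
    have hf (y) : f y = g • y := by
      obtain ⟨y, rfl⟩ := Submodule.mkQ_surjective _ y
      rw [← mul_one y, ← smul_eq_mul, map_smul, map_smul, ← hg, smul_comm, ← map_smul _ g]
      simp
    refine ⟨g, LinearMap.ext fun v => o.injective ?_⟩
    have h2 (v) : ε i (ξ (ε i v)) = g • ε i v := by
      apply Φ.injective
      have := hf (DirectSum.component F[X] ι (fun i => F[X] ⧸ F[X] ∙ q i ^ k i) i (Φ v))
      rw [map_smul]
      simp only [ε, LinearMap.comp_apply, LinearEquiv.coe_coe,
        LinearEquiv.apply_symm_apply] at this ⊢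
      rw [← map_smul, ← this]
      rfl
    simp only [Module.End.mul_apply, hX, down_apply, o.apply_symm_apply]
    exact h2 (o v)

/-- A central simple algebra with a nonzero idempotent whose corner consists of scalars is
split. -/
theorem brauerClass_eq_one_of_corner {L : Type} [Field L] {S : Type} [Ring S] [Algebra L S]
    [Algebra.IsCentral L S] [IsSimpleRing S] [FiniteDimensional L S] {e : S} (he : e * e = e)
    (he0 : e ≠ 0) (h : ∀ x, ∃ c : L, e * x * e = c • e) : brauerClass L S = 1 := by
  classical
  let M : Submodule L S := LinearMap.range (LinearMap.mulRight L e)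
  have hM (v : M) : (v : S) * e = v := by
    obtain ⟨w, hw⟩ := v.2
    rw [← hw, LinearMap.mulRight_apply, mul_assoc, he]
  have hmem (x : S) : x * e ∈ M := ⟨x, rfl⟩
  let f : S →ₐ[L] Module.End L M :=
    { toFun x := (LinearMap.mulLeft L x).restrict (p := M) (q := M) fun v hv => by
        have : v * e = v := hM ⟨v, hv⟩
        rw [LinearMap.mulLeft_apply, ← this, ← mul_assoc]
        exact hmem _
      map_one' := LinearMap.ext fun v => Subtype.ext (by simp)
      map_mul' x y := LinearMap.ext fun v => Subtype.ext (by simp)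
      map_zero' := LinearMap.ext fun v => Subtype.ext (by simp)
      map_add' x y := LinearMap.ext fun v => Subtype.ext (by simp [add_mul])
      commutes' c := LinearMap.ext fun v => Subtype.ext (by simp [Algebra.smul_def]) }
  have f_apply x (v : M) : (f x v : S) = x * v := rfl
  have : Nontrivial M := ⟨⟨⟨e, by simpa using hmem 1⟩, 0, fun h => he0 (congrArg Subtype.val h)⟩⟩
  have hspan : (1 : S) ∈ TwoSidedIdeal.span {e} := by
    have : TwoSidedIdeal.span {e} = ⊤ := by
      refine (IsSimpleOrder.eq_bot_or_eq_top (TwoSidedIdeal.span {e})).resolve_left fun hb => he0 ?_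
      have : e ∈ TwoSidedIdeal.span {e} := TwoSidedIdeal.subset_span rfl
      rwa [hb, TwoSidedIdeal.mem_bot] at this
    rw [this]
    trivial
  have hsurj : Function.Surjective f := fun φ => by
    suffices ∃ t, φ * f 1 = f t by
      obtain ⟨t, ht⟩ := this
      exact ⟨t, by rw [← ht, map_one, mul_one]⟩
    rw [TwoSidedIdeal.mem_span_iff_mem_addSubgroup_closure] at hspan
    generalize (1 : S) = y at hspan ⊢
    induction hspan using AddSubgroup.closure_induction with
    | mem y hy =>
      obtain ⟨_, ⟨a, _, e', he', rfl⟩, b, _, rfl⟩ := hy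
      obtain rfl : e' = e := he'
      refine ⟨φ ⟨a * e', hmem _⟩ * b, LinearMap.ext fun v => Subtype.ext ?_⟩
      obtain ⟨c, hc⟩ := h (b * v)
      rw [mul_assoc, mul_assoc, hM] at hc
      have h1 : f (a * e' * b) v = c • (⟨a * e', hmem _⟩ : M) := Subtype.ext <| by
        rw [f_apply, mul_assoc, mul_assoc, hc, mul_smul_comm]
        rfl
      rw [Module.End.mul_apply, h1, map_smul, f_apply, ← hM (φ _), mul_assoc, mul_assoc, hc,
        mul_smul_comm, hM]
      rfl
    | zero => exact ⟨0, by simp⟩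
    | add x y _ _ hx hy =>
      obtain ⟨t, ht⟩ := hx
      obtain ⟨u, hu⟩ := hy
      exact ⟨t + u, by rw [map_add, mul_add, ht, hu, map_add]⟩
    | neg x _ hx =>
      obtain ⟨t, ht⟩ := hx
      refine ⟨-t, ?_⟩
      rw [map_neg, map_neg, ← ht]
      exact LinearMap.ext fun v => by simp
  exact brauerClass_eq_one_of_algEquiv_end
    (AlgEquiv.ofBijective f ⟨f.toRingHom.injective, hsurj⟩)

end Corner

section CyclicShift

open PiTensorProduct
open scoped Fin.CommRing

variable {p : ℕ} [Fact p.Prime] {F : Type} [Field F] {A : Type} [Ring A] [Algebra F A]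

/-- The cyclic shift by `k` of the factors of a tensor power. -/
noncomputable def cyclicShift (F A : Type) [Field F] [Ring A] [Algebra F A] (k : Fin p) :
    (⨂[F] _ : Fin p, A) →ₐ[F] ⨂[F] _ : Fin p, A :=
  liftAlgHom ((PiTensorProduct.tprod F).domDomCongr (Equiv.addRight k).symm)
    (by simp [one_def, MultilinearMap.domDomCongr_apply, Pi.one_def])
    (fun x y => by
      simp only [MultilinearMap.domDomCongr_apply, tprod_mul_tprod]
      rfl)

theorem cyclicShift_tprod (k : Fin p) (x : Fin p → A) :
    cyclicShift F A k (PiTensorProduct.tprod F x) = PiTensorProduct.tprod F fun i => x (i - k) := by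
  simp [cyclicShift, MultilinearMap.domDomCongr_apply, sub_eq_add_neg]

theorem cyclicShift_add (k l : Fin p) (t : ⨂[F] _ : Fin p, A) :
    cyclicShift F A (k + l) t = cyclicShift F A k (cyclicShift F A l t) := by
  induction t using PiTensorProduct.induction_on with
  | smul_tprod r f =>
    simp only [map_smul, cyclicShift_tprod]
    exact congrArg (fun x => r • PiTensorProduct.tprod F x)
      (funext fun i => congrArg f (sub_sub i k l).symm)
  | add x y hx hy => simp only [map_add, hx, hy]

theorem cyclicShift_zero (t : ⨂[F] _ : Fin p, A) : cyclicShift F A (0 : Fin p) t = t := by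
  induction t using PiTensorProduct.induction_on with
  | smul_tprod r f =>
    simp only [map_smul, cyclicShift_tprod]
    exact congrArg (fun x => r • PiTensorProduct.tprod F x)
      (funext fun i => congrArg f (sub_zero i))
  | add x y hx hy => simp only [map_add, hx, hy]

theorem cyclicShift_eq_of_one {t : ⨂[F] _ : Fin p, A} (h : cyclicShift F A (1 : Fin p) t = t)
    (k : Fin p) : cyclicShift F A k t = t := by
  rw [← Fin.cast_val_eq_self k]
  induction (k : ℕ) with
  | zero => rw [Nat.cast_zero, cyclicShift_zero]
  | succ n ih => rw [Nat.cast_succ, cyclicShift_add, h, ih]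

/-- The sum of all cyclic shifts of an element of a tensor power. -/
noncomputable def cyclicNorm (t : ⨂[F] _ : Fin p, A) : ⨂[F] _ : Fin p, A :=
  ∑ k : Fin p, cyclicShift F A k t

theorem cyclicNorm_mul {t : ⨂[F] _ : Fin p, A} (z) (h : ∀ k : Fin p, cyclicShift F A k t = t) :
    cyclicNorm z * t = cyclicNorm (z * t) := by
  simp only [cyclicNorm, Finset.sum_mul, map_mul, h]

theorem mul_cyclicNorm {t : ⨂[F] _ : Fin p, A} (z) (h : ∀ k : Fin p, cyclicShift F A k t = t) :
    t * cyclicNorm z = cyclicNorm (t * z) := by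
  simp only [cyclicNorm, Finset.mul_sum, map_mul, h]

variable {κ : Type} (b : Module.Basis κ F A)

theorem repr_cyclicShift (k : Fin p) (t : ⨂[F] _ : Fin p, A) (f : Fin p → κ) :
    (Basis.piTensorProduct fun _ : Fin p => b).repr (cyclicShift F A k t) f =
      (Basis.piTensorProduct fun _ : Fin p => b).repr t fun i => f (i + k) := by
  induction t using PiTensorProduct.induction_on with
  | smul_tprod r x =>
    simp only [map_smul, cyclicShift_tprod, Finsupp.smul_apply,
      Basis.piTensorProduct_repr_tprod_apply]
    congr 1
    exact (Equiv.prod_comp (Equiv.addRight k) _).symm.trans (by simp)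
  | add x y hx hy => simp only [map_add, Finsupp.add_apply, hx, hy]

/-- A weight function on nonconstant maps whose sum over each cyclic orbit is one. -/
theorem exists_cyclic_weight [CharP F p] : ∃ w : (Fin p → κ) → F, ∀ f : Fin p → κ,
    (¬ ∃ q, f = fun _ => q) → ∑ k, w (fun i => f (i + k)) = 1 := by
  classical
  let a (f : Fin p → κ) : κ :=
    haveI : Nonempty κ := ⟨f 0⟩
    Classical.epsilon (· ∈ Set.range f)
  have ha (f) : ∃ i, f i = a f :=
    haveI : Nonempty κ := ⟨f 0⟩
    Classical.epsilon_spec (p := (· ∈ Set.range f)) ⟨f 0, 0, rfl⟩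
  have ha' (f : Fin p → κ) (k) : a (fun i => f (i + k)) = a f := by
    have : Set.range (fun i => f (i + k)) = Set.range f :=
      (Equiv.addRight k).surjective.range_comp f
    simp only [a, this]
  let m (f : Fin p → κ) : ℕ := (Finset.univ.filter fun i => f i = a f).card
  have hm (f : Fin p → κ) (k) : m (fun i => f (i + k)) = m f := by
    simp only [m, ha']
    exact Finset.card_bij (fun i _ => i + k) (by simp) (by simp)
      fun i hi => ⟨i - k, by simpa using hi, by simp⟩
  refine ⟨fun f => if f 0 = a f then (m f : F)⁻¹ else 0, fun f hf => ?_⟩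
  have h0 : (m f : F) ≠ 0 := by
    rw [Ne, CharP.cast_eq_zero_iff F p]
    refine Nat.not_dvd_of_pos_of_lt (Finset.card_pos.mpr ?_) ?_
    · obtain ⟨i, hi⟩ := ha f
      exact ⟨i, by simpa using hi⟩
    · conv_rhs => rw [← Fintype.card_fin p]
      refine Finset.card_lt_univ_of_notMem
        (x := (not_forall.mp fun h => hf ⟨a f, funext h⟩).choose) ?_
      simpa using (not_forall.mp fun h => hf ⟨a f, funext h⟩).choose_spec
  simp only [ha', hm, zero_add]
  rw [← Finset.sum_filter, Finset.sum_const, nsmul_eq_mul]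
  exact mul_inv_cancel₀ h0

theorem exists_cyclicNorm_eq [Fintype κ] [CharP F p] {t : ⨂[F] _ : Fin p, A}
    (h : ∀ k : Fin p, cyclicShift F A k t = t)
    (h0 : ∀ q, (Basis.piTensorProduct fun _ : Fin p => b).repr t (fun _ => q) = 0) :
    ∃ z, cyclicNorm z = t := by
  obtain ⟨w, hw⟩ := exists_cyclic_weight (p := p) (F := F) (κ := κ)
  classical
  let B := Basis.piTensorProduct fun _ : Fin p => b
  refine ⟨∑ f, (B.repr t f * w f) • B f, B.ext_elem fun f => ?_⟩
  have hz (f) : B.repr (∑ f, (B.repr t f * w f) • B f) f = B.repr t f * w f := by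
    rw [B.repr_sum_self]
  have h1 (k) : B.repr t (fun i => f (i + k)) = B.repr t f := by
    rw [← repr_cyclicShift, h]
  have h2 (k z) : B.repr (cyclicShift F A k z) f = B.repr z (fun i => f (i + k)) :=
    repr_cyclicShift b k z f
  rw [cyclicNorm, map_sum, Finsupp.finsetSum_apply]
  simp only [h2, hz, h1]
  rw [← Finset.mul_sum]
  by_cases hf : ∃ q, f = fun _ => q
  · obtain ⟨q, rfl⟩ := hf
    rw [h0, zero_mul]
  · rw [hw f hf, mul_one]

theorem repr_cyclicNorm [CharP F p] (z : ⨂[F] _ : Fin p, A) (q : κ) :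
    (Basis.piTensorProduct fun _ : Fin p => b).repr (cyclicNorm z) (fun _ => q) = 0 := by
  rw [cyclicNorm, map_sum, Finsupp.finsetSum_apply]
  simp [repr_cyclicShift]

end CyclicShift

section Frobenius

open PiTensorProduct
open scoped Fin.CommRing

variable {p : ℕ} [Fact p.Prime] {F : Type} [Field F] [CharP F p] {A : Type} [Ring A] [Algebra F A]
  {L : Type} [Field L] [Algebra F L] (e : F ≃+* L) {κ : Type} [Fintype κ] (b : Module.Basis κ F A)

/-- The map from the tensor power `A^{⊗p}` to the Frobenius twist of `A` reading off the
coefficients of the diagonal basis vectors. -/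
noncomputable def frobeniusDiag : (⨂[F] _ : Fin p, A) →+ L ⊗[F] A where
  toFun t := ∑ q, e ((Basis.piTensorProduct fun _ : Fin p => b).repr t fun _ => q) ⊗ₜ[F] b q
  map_zero' := by simp
  map_add' t u := by simp [TensorProduct.add_tmul, Finset.sum_add_distrib]

theorem frobeniusDiag_apply (t : ⨂[F] _ : Fin p, A) : frobeniusDiag e b t =
    ∑ q, e ((Basis.piTensorProduct fun _ : Fin p => b).repr t fun _ => q) ⊗ₜ[F] b q := rfl

theorem frobeniusDiag_smul (c : F) (t : ⨂[F] _ : Fin p, A) :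
    frobeniusDiag e b (c • t) = e c • frobeniusDiag e b t := by
  simp [frobeniusDiag_apply, Finset.smul_sum, TensorProduct.smul_tmul']

theorem frobeniusDiag_cyclicNorm (z : ⨂[F] _ : Fin p, A) :
    frobeniusDiag e b (cyclicNorm z) = 0 := by
  simp [frobeniusDiag_apply, repr_cyclicNorm]

variable {e}

theorem frobeniusDiag_tprod (he : ∀ x, algebraMap F L x = e x ^ p) (x : A) :
    frobeniusDiag e b (PiTensorProduct.tprod F fun _ : Fin p => x) = 1 ⊗ₜ x := by
  conv_rhs => rw [← b.sum_repr x, TensorProduct.tmul_sum]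
  rw [frobeniusDiag_apply]
  refine Finset.sum_congr rfl fun q _ => ?_
  rw [Basis.piTensorProduct_repr_tprod_apply, Finset.prod_const, Finset.card_univ,
    Fintype.card_fin, map_pow, ← he, ← TensorProduct.smul_tmul, Algebra.algebraMap_eq_smul_one]

theorem frobeniusDiag_one (he : ∀ x, algebraMap F L x = e x ^ p) :
    frobeniusDiag e b (1 : ⨂[F] _ : Fin p, A) = 1 :=
  frobeniusDiag_tprod b he 1

theorem exists_eq_sum_add_cyclicNorm {t : ⨂[F] _ : Fin p, A}
    (h : ∀ k : Fin p, cyclicShift F A k t = t) : ∃ (c : κ → F) (z : ⨂[F] _ : Fin p, A),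
      t = ∑ q, c q • PiTensorProduct.tprod F (fun _ : Fin p => b q) + cyclicNorm z := by
  classical
  let B := Basis.piTensorProduct fun _ : Fin p => b
  let u := ∑ q, B.repr t (fun _ => q) • PiTensorProduct.tprod F (fun _ : Fin p => b q)
  obtain ⟨z, hz⟩ := exists_cyclicNorm_eq b (t := t - u) (fun k => by
    rw [map_sub, h]
    simp [u, cyclicShift_tprod]) (fun r => by
    rw [map_sub, Finsupp.sub_apply, map_sum, Finsupp.finsetSum_apply, Finset.sum_eq_single r]
    · simp [B, -Basis.piTensorProduct_apply]
    · intro q _ hq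
      simp [B, Finsupp.single_eq_of_ne' hq, (Fact.out : p.Prime).ne_zero]
    · simp)
  exact ⟨_, z, by rw [hz, add_sub_cancel]⟩

theorem frobeniusDiag_mul (he : ∀ x, algebraMap F L x = e x ^ p)
    {t u : ⨂[F] _ : Fin p, A} (ht : ∀ k : Fin p, cyclicShift F A k t = t)
    (hu : ∀ k : Fin p, cyclicShift F A k u = u) :
    frobeniusDiag e b (t * u) = frobeniusDiag e b t * frobeniusDiag e b u := by
  have hb (q k) : cyclicShift F A k (PiTensorProduct.tprod F (fun _ : Fin p => b q)) =
      PiTensorProduct.tprod F (fun _ : Fin p => b q) := cyclicShift_tprod _ _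
  obtain ⟨c, z, rfl⟩ := exists_eq_sum_add_cyclicNorm b ht
  rw [add_mul, cyclicNorm_mul _ hu, map_add, map_add, frobeniusDiag_cyclicNorm,
    frobeniusDiag_cyclicNorm, add_zero, add_zero]
  obtain ⟨d, y, rfl⟩ := exists_eq_sum_add_cyclicNorm b hu
  rw [mul_add, mul_cyclicNorm _ (by simp [hb]), map_add, map_add, frobeniusDiag_cyclicNorm,
    frobeniusDiag_cyclicNorm, add_zero, add_zero]
  simp only [Finset.sum_mul, Finset.mul_sum, map_sum]
  refine Finset.sum_congr rfl fun q _ => Finset.sum_congr rfl fun r _ => ?_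
  have hmul (q r : κ) : PiTensorProduct.tprod F (fun _ : Fin p => b q) *
      PiTensorProduct.tprod F (fun _ : Fin p => b r) =
      PiTensorProduct.tprod F (fun _ : Fin p => b q * b r) := tprod_mul_tprod _ _
  simp only [smul_mul_smul_comm, hmul, frobeniusDiag_smul, frobeniusDiag_tprod b he,
    Algebra.TensorProduct.tmul_mul_tmul, mul_one, map_mul]

theorem exists_frobeniusDiag_eq (he : ∀ x, algebraMap F L x = e x ^ p) (y : L ⊗[F] A) :
    ∃ t : ⨂[F] _ : Fin p, A, (∀ k : Fin p, cyclicShift F A k t = t) ∧ frobeniusDiag e b t = y := by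
  induction y with
  | zero => exact ⟨0, by simp, by simp⟩
  | tmul l a =>
    refine ⟨e.symm l • PiTensorProduct.tprod F fun _ => a, fun k => ?_, ?_⟩
    · rw [map_smul, cyclicShift_tprod]
    · rw [frobeniusDiag_smul, frobeniusDiag_tprod b he, TensorProduct.smul_tmul']
      simp
  | add x y hx hy =>
    obtain ⟨t, ht, rfl⟩ := hx
    obtain ⟨u, hu, rfl⟩ := hy
    exact ⟨t + u, fun k => by rw [map_add, ht, hu], map_add _ _ _⟩

/-- A central simple algebra over a field of characteristic `p` whose class is killed by `p` is
split by the Frobenius base change. -/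
theorem res_frobenius_eq_one [Algebra.IsCentral F A] [IsSimpleRing A] [FiniteDimensional F A]
    (he : ∀ x, algebraMap F L x = e x ^ p) (h : brauerClass F A ^ p = 1) :
    BrauerGroup.res F L (brauerClass F A) = 1 := by
  classical
  obtain ⟨_, _, _, hT⟩ := brauerClass_piTensorProduct (F := F) fun _ : Fin p => A
  rw [Finset.prod_const, Finset.card_univ, Fintype.card_fin, h] at hT
  obtain ⟨W, _, _, _, _, ⟨Ψ⟩⟩ := exists_algEquiv_end_of_brauerClass_eq_one hT
  let σ : (⨂[F] _ : Fin p, A) ≃ₐ[F] ⨂[F] _ : Fin p, A :=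
    AlgEquiv.ofAlgHom (cyclicShift F A (1 : Fin p)) (cyclicShift F A (-1 : Fin p))
      (AlgHom.ext fun t => by
        rw [AlgHom.comp_apply, ← cyclicShift_add, add_neg_cancel, cyclicShift_zero]
        rfl)
      (AlgHom.ext fun t => by
        rw [AlgHom.comp_apply, ← cyclicShift_add, neg_add_cancel, cyclicShift_zero]
        rfl)
  obtain ⟨s, hs⟩ := ((Ψ.symm.trans σ).trans Ψ).eq_linearEquivConjAlgEquiv
  have hinv (x : Module.End F W) :
      Commute (s : Module.End F W) x ↔ ∀ k : Fin p, cyclicShift F A k (Ψ.symm x) = Ψ.symm x := by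
    have h1 : Ψ (cyclicShift F A (1 : Fin p) (Ψ.symm x)) * s = s * x := by
      refine LinearMap.ext fun v => ?_
      have h2 := congr($hs x (s v))
      simp only [LinearEquiv.conjAlgEquiv_apply, LinearMap.comp_apply, LinearEquiv.coe_coe,
        LinearEquiv.symm_apply_apply] at h2
      exact h2
    refine ⟨fun h => cyclicShift_eq_of_one (Ψ.injective ?_), fun h => ?_⟩
    · rw [h.eq] at h1
      refine LinearMap.ext fun v => ?_
      simpa using congr($h1 (s.symm v))
    · rw [h, Ψ.apply_symm_apply] at h1
      exact h1.symm
  obtain ⟨ι, _, ε, hε, hidem, hsum, hcorner⟩ :=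
    Module.End.exists_idempotents_commute (s : Module.End F W)
  let b := Module.finBasis F A
  let φ (x : Module.End F W) : L ⊗[F] A := frobeniusDiag e b (Ψ.symm x)
  have hφmul {x y} (hx : Commute (s : Module.End F W) x) (hy : Commute (s : Module.End F W) y) :
      φ (x * y) = φ x * φ y := by
    simp only [φ, map_mul]
    exact frobeniusDiag_mul b he ((hinv x).mp hx) ((hinv y).mp hy)
  have hφone : φ 1 = 1 := by
    simp only [φ, map_one]
    exact frobeniusDiag_one b he
  have hφsurj (y) : ∃ x, Commute (s : Module.End F W) x ∧ φ x = y := by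
    obtain ⟨t, ht, rfl⟩ := exists_frobeniusDiag_eq (p := p) b he y
    exact ⟨Ψ t, (hinv _).mpr (by simpa using ht), by simp [φ]⟩
  have hss : Commute (s : Module.End F W) (s : Module.End F W) := Commute.refl _
  obtain ⟨l, hl⟩ : ∃ l : L, algebraMap L (L ⊗[F] A) l = φ s := by
    have : φ s ∈ Subalgebra.center L (L ⊗[F] A) := by
      rw [Subalgebra.mem_center_iff]
      intro y
      obtain ⟨x, hx, rfl⟩ := hφsurj y
      rw [← hφmul hx hss, ← hφmul hss hx, hx.eq]
    rwa [Algebra.IsCentral.center_eq_bot, Algebra.mem_bot] at this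
  have hpoly (g : Polynomial F) :
      Commute (s : Module.End F W) (Polynomial.aeval (s : Module.End F W) g) ∧
      ∃ c : L, φ (Polynomial.aeval (s : Module.End F W) g) = algebraMap L _ c := by
    induction g using Polynomial.induction_on with
    | C c =>
      rw [Polynomial.aeval_C]
      refine ⟨Algebra.commute_algebraMap_right c _, e c, ?_⟩
      simp only [φ, Algebra.algebraMap_eq_smul_one, map_smul, frobeniusDiag_smul, map_one,
        frobeniusDiag_one b he]
    | add f g hf hg =>
      obtain ⟨hf, c, hc⟩ := hf
      obtain ⟨hg, d, hd⟩ := hg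
      rw [map_add]
      refine ⟨hf.add_right hg, c + d, ?_⟩
      rw [map_add, ← hc, ← hd]
      simp [φ]
    | monomial n a ih =>
      obtain ⟨h1, c, hc⟩ := ih
      rw [pow_succ, ← mul_assoc, map_mul _ _ Polynomial.X, Polynomial.aeval_X]
      exact ⟨h1.mul_right hss, c * l, by rw [hφmul h1 hss, hc, ← hl, map_mul]⟩
  obtain ⟨i, hi⟩ : ∃ i, φ (ε i) ≠ 0 := by
    by_contra! hzero
    have : φ 1 = ∑ i, φ (ε i) := by
      rw [← hsum]
      simp [φ]
    simp only [hφone, hzero, Finset.sum_const_zero, one_ne_zero] at this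
  rw [BrauerGroup.res_brauerClass]
  refine brauerClass_eq_one_of_corner (e := φ (ε i)) ?_ hi fun y => ?_
  · rw [← hφmul (hε i) (hε i), hidem]
  · obtain ⟨x, hx, rfl⟩ := hφsurj y
    obtain ⟨g, hg⟩ := hcorner i x hx
    obtain ⟨h1, c, hc⟩ := hpoly g
    refine ⟨c, ?_⟩
    rw [← hφmul (hε i) hx, ← hφmul ((hε i).mul_right hx) (hε i), hg, hφmul h1 (hε i), hc,
      Algebra.smul_def]

end Frobenius

section InseparableExtension

variable {p : ℕ} [Fact p.Prime] {F K : Type} [Field F] [Field K] [Algebra F K]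

theorem minpoly.natDegree_eq_of_finrank_eq_prime (hK : Module.finrank F K = p) {c : K}
    (hc : c ∉ (algebraMap F K).range) : (minpoly F c).natDegree = p := by
  have hp := (Fact.out : p.Prime)
  have : FiniteDimensional F K := Module.finite_of_finrank_pos (hK ▸ hp.pos)
  have h := minpoly.degree_dvd (Algebra.IsIntegral.isIntegral (R := F) c)
  rw [hK, Nat.dvd_prime hp, minpoly.natDegree_eq_one_iff] at h
  exact h.resolve_left hc

theorem exists_basis_pow_of_finrank_eq_prime (hK : Module.finrank F K = p) {c : K}
    (hc : c ∉ (algebraMap F K).range) :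
    ∃ B : Module.Basis (Fin p) F K, ∀ k, B k = c ^ (k : ℕ) := by
  have h := linearIndependent_pow (K := F) c
  rw [minpoly.natDegree_eq_of_finrank_eq_prime hK hc] at h
  have : NeZero p := ⟨(Fact.out : p.Prime).ne_zero⟩
  exact ⟨basisOfLinearIndependentOfCardEqFinrank h (by simp [hK]), fun k => by simp⟩

theorem pow_mem_range_of_not_isSeparable [CharP F p] (hK : Module.finrank F K = p)
    (hsep : ¬ Algebra.IsSeparable F K) (z : K) : ∃ x : F, algebraMap F K x = z ^ p := by
  have hp := (Fact.out : p.Prime)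
  have : FiniteDimensional F K := Module.finite_of_finrank_pos (hK ▸ hp.pos)
  have : ExpChar F p := ExpChar.prime hp
  have : IsPurelyInseparable F K := by
    rw [isPurelyInseparable_iff]
    refine fun x => ⟨Algebra.IsIntegral.isIntegral x, fun hx => ?_⟩
    by_contra hxF
    refine hsep ((separableClosure.eq_top_iff F K).mp ?_)
    obtain ⟨B, hB⟩ := exists_basis_pow_of_finrank_eq_prime hK hxF
    refine eq_top_iff.mpr fun v _ => ?_
    rw [← B.sum_repr v]
    refine sum_mem fun k _ => IntermediateField.smul_mem _ ?_
    rw [hB]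
    exact pow_mem (mem_separableClosure_iff.mpr hx) _
  by_cases hz : z ∈ (algebraMap F K).range
  · obtain ⟨x, rfl⟩ := hz
    exact ⟨x ^ p, map_pow _ _ _⟩
  · obtain ⟨n, y, hy⟩ := IsPurelyInseparable.minpoly_eq_X_pow_sub_C F p z
    have hdeg := minpoly.natDegree_eq_of_finrank_eq_prime hK hz
    rw [hy, Polynomial.natDegree_X_pow_sub_C] at hdeg
    refine ⟨y, ?_⟩
    have h := minpoly.aeval F z
    rw [hy, hdeg] at h
    exact (sub_eq_zero.mp (by simpa using h)).symm

end InseparableExtension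

section Descent

variable {p : ℕ} [Fact p.Prime] {F : Type} [Field F] [CharP F p] {K : Type} [Field K] [Algebra F K]
  [CharP K p]

theorem BrauerGroup.exists_eq_symb_of_res_eq_one {b : F} {β : K} (hb : b ≠ 0)
    (hβ : β ^ p = algebraMap F K b) (B : Module.Basis (Fin p) F K) (hB : ∀ k, B k = β ^ (k : ℕ))
    (x : BrauerGroup.{0, 0} F) (h : BrauerGroup.res F K x = 1) : ∃ z : F, x = symb p z b := by
  induction x using BrauerGroup.ind_on with | h A
  exact exists_brauerClass_eq_symb hb hβ B hB h

/-- A class that becomes a product of symbols defined over the base field is a product of these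
symbols and one further symbol. -/
theorem symbolLengthLE_of_res_eq_prod {A : Type} [Ring A] [Algebra F A] [Algebra.IsCentral F A]
    [IsSimpleRing A] [FiniteDimensional F A] {b : F} {β : K} (hb : b ≠ 0)
    (hβ : β ^ p = algebraMap F K b) (B : Module.Basis (Fin p) F K) (hB : ∀ k, B k = β ^ (k : ℕ))
    {ι : Type} [Fintype ι] {m : ℕ} (hm : Fintype.card ι + 1 ≤ m) (x d : ι → F)
    (h : BrauerGroup.res F K (brauerClass F A) =
      ∏ t, symb p (algebraMap F K (x t)) (algebraMap F K (d t))) :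
    SymbolLengthLE p F A m := by
  obtain ⟨z, hz⟩ := BrauerGroup.exists_eq_symb_of_res_eq_one hb hβ B hB
    (brauerClass F A / ∏ t, symb p (x t) (d t)) (by
      rw [map_div, h, map_prod, div_eq_one]
      exact Finset.prod_congr rfl fun t _ => (BrauerGroup.res_symb p (x t) (d t) K).symm)
  refine symbolLengthLE_of_brauerClass_eq_prod (ι := Option ι) (by simpa using hm)
    (fun t => t.elim z x) (fun t => t.elim b d) ?_
  rw [Fintype.prod_option, ← div_mul_cancel (brauerClass F A) (∏ t, symb p (x t) (d t)), hz]
  rfl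

/-- A symbol over an extension of exponent one generated by `β` is a product of `p` symbols over
the base field and one symbol with second entry `β`. -/
theorem exists_symb_eq_prod_mul_symb (hpow : ∀ z : K, ∃ x : F, algebraMap F K x = z ^ p) {β : K}
    (hβ0 : β ≠ 0) (B : Module.Basis (Fin p) F K) (hB : ∀ k, B k = β ^ (k : ℕ)) (a : K) {c : K}
    (hc : c ≠ 0) : ∃ (x d : Fin p → F) (y : F), symb p a c =
      (∏ j, symb p (algebraMap F K (x j)) (algebraMap F K (d j))) *
        symb p (algebraMap F K y) β := by
  let d (j : Fin p) : F := B.repr c j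
  have hcd : c = ∑ j, algebraMap F K (d j) * β ^ (j : ℕ) := by
    conv_lhs => rw [← B.sum_repr c]
    exact Finset.sum_congr rfl fun j _ => by rw [hB, Algebra.smul_def]
  let u (j : Fin p) : K := a / c * (algebraMap F K (d j) * β ^ (j : ℕ))
  have hu (j) : symb p (u j) (algebraMap F K (d j) * β ^ (j : ℕ)) =
      symb p (u j) (algebraMap F K (d j)) * symb p ((j : ℕ) * u j) β := by
    by_cases hd : d j = 0
    · simp [u, hd, symb_zero_left]
    · rw [symb_mul ((map_ne_zero _).mpr hd) (pow_ne_zero _ hβ0), symb_pow, symb_nsmul]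
  choose ρ hρ using hpow
  refine ⟨fun j => ρ (u j), d, ρ (∑ j : Fin p, (j : ℕ) * u j), ?_⟩
  simp only [hρ, symb_pow_left]
  rw [symb_sum, ← Finset.prod_mul_distrib]
  simp only [← hu]
  have h := symb_sum_right (p := p) Finset.univ
    (fun j : Fin p => algebraMap F K (d j) * β ^ (j : ℕ)) a (hcd ▸ hc)
  rw [← hcd] at h
  exact h

/-- A symbol with second entry `β` over `F(β)`, where `β ^ p = b`, which becomes trivial under the
Frobenius twist, is a product of `p - 1` symbols over `F`. -/
theorem exists_symb_eq_prod_of_eq_add_sum (hpow : ∀ z : K, ∃ x : F, algebraMap F K x = z ^ p)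
    {b : F} {β : K} (hβ : β ^ p = algebraMap F K b) (g : ℕ → F) {n : ℕ} (hn : n < p) :
    ∃ x : Fin n → F, symb p (algebraMap F K
      (g 0 ^ p - g 0 + ∑ k ∈ Finset.range n, g (k + 1) ^ p * b ^ (k + 1))) β =
      ∏ k : Fin n, symb p (algebraMap F K (x k)) (algebraMap F K (g (k + 1))) := by
  choose ρ hρ using hpow
  choose m hm using fun k : Fin n => exists_symb_mul_pow_eq (p := p) (algebraMap F K (g (k + 1))) β
    k.1.succ_pos (by omega)
  refine ⟨fun k => ρ (m k * (algebraMap F K (g (k + 1)) * β ^ (k + 1 : ℕ))), ?_⟩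
  simp only [hρ, symb_pow_left]
  rw [map_add, map_sub, map_pow, symb_add, symb_artinSchreier, one_mul, map_sum, symb_sum,
    Finset.prod_range]
  refine Finset.prod_congr rfl fun k _ => ?_
  rw [← hm, map_mul, map_pow, map_pow, ← hβ, ← pow_mul, mul_comm p, pow_mul, ← mul_pow,
    symb_pow_left]

/-- The field `F`, regarded as an extension of itself through the Frobenius endomorphism. -/
def FrobeniusTwist (F : Type) : Type := F

/-- If a class killed by `p` restricts to `F(β)` as a product of symbols over `F` and a symbol
`[y, β)`, then `y` has a special form. -/
theorem exists_eq_add_sum_of_res_eq {A : Type} [Ring A] [Algebra F A] [Algebra.IsCentral F A]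
    [IsSimpleRing A] [FiniteDimensional F A] (hA : brauerClass F A ^ p = 1)
    (hpow : ∀ z : K, ∃ x : F, algebraMap F K x = z ^ p)
    {b : F} {β : K} (hβ : β ^ p = algebraMap F K b) (hβF : β ∉ (algebraMap F K).range)
    {ι : Type} [Fintype ι] (x d : ι → F) (y : F)
    (h : BrauerGroup.res F K (brauerClass F A) =
      (∏ t, symb p (algebraMap F K (x t)) (algebraMap F K (d t))) *
        symb p (algebraMap F K y) β) :
    ∃ g : ℕ → F, y = g 0 ^ p - g 0 + ∑ k ∈ Finset.range (p - 1), g (k + 1) ^ p * b ^ (k + 1) := by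
  have hinj := (algebraMap F K).injective
  choose ρ hρ using hpow
  let _ : Field (FrobeniusTwist F) := inferInstanceAs (Field F)
  have : CharP (FrobeniusTwist F) p := inferInstanceAs (CharP F p)
  let e : F ≃+* FrobeniusTwist F := RingEquiv.refl F
  let ψ : K →+* FrobeniusTwist F := e.toRingHom.comp
    { toFun := ρ
      map_one' := hinj (by simp [hρ])
      map_mul' z w := hinj (by simp [hρ, mul_pow])
      map_zero' := hinj (by simp [hρ, (Fact.out : p.Prime).ne_zero])
      map_add' z w := hinj (by simp [hρ, add_pow_char]) }
  let _ : Algebra K (FrobeniusTwist F) := ψ.toAlgebra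
  let _ : Algebra F (FrobeniusTwist F) := (e.toRingHom.comp (frobenius F p)).toAlgebra
  have he (z : F) : algebraMap F (FrobeniusTwist F) z = e z ^ p := map_pow e z p
  have hψ (z : F) : algebraMap K (FrobeniusTwist F) (algebraMap F K z) = e z ^ p := by
    have h : ρ (algebraMap F K z) = z ^ p := hinj (by rw [hρ, map_pow])
    rw [← map_pow]
    exact congrArg e h
  have : IsScalarTower F K (FrobeniusTwist F) :=
    IsScalarTower.of_algebraMap_eq fun z => by rw [he, hψ]
  have hψβ : algebraMap K (FrobeniusTwist F) β = e b := by
    have h : ρ β = b := hinj (by rw [hρ, hβ])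
    exact congrArg e h
  have h1 := res_frobenius_eq_one he hA
  rw [← BrauerGroup.res_res F K, h, map_mul, map_prod] at h1
  simp only [BrauerGroup.res_symb, hψ, symb_pow_card_right, Finset.prod_const_one, one_mul, hψβ,
    symb_pow_left] at h1
  refine exists_eq_of_symb_eq_one (F := F) (fun w hw => hβF ⟨w, ?_⟩) h1
  exact frobenius_inj K p (by simp [frobenius_def, hβ, ← hw])

end Descent

section Assembly

variable {p : ℕ} [Fact p.Prime] {F : Type} [Field F] {A : Type} [Ring A] [Algebra F A]
  [Algebra.IsCentral F A] [IsSimpleRing A] [FiniteDimensional F A]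

theorem HasExponent.brauerClass_pow_eq_one {e : ℕ} (h : HasExponent F A e) :
    brauerClass F A ^ e = 1 := by
  obtain ⟨-, ⟨m, hm, ⟨f⟩⟩, -⟩ := h
  obtain ⟨_, _, _, h⟩ := brauerClass_piTensorProduct (F := F) fun _ : Fin e => A
  have : NeZero m := ⟨hm.ne'⟩
  rw [Fin.prod_const] at h
  rw [← h]
  exact brauerClass_eq_one_of_algEquiv_end (f.trans Matrix.toLinAlgEquiv')

variable [CharP F p] {K : Type} [Field K] [Algebra F K] [CharP K p]

/-- The case where the second entries of the symbols lie in the base field. -/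
theorem symbolLengthLE_of_forall_mem_range (hK : Module.finrank F K = p)
    (hpow : ∀ z : K, ∃ x : F, algebraMap F K x = z ^ p) {k m : ℕ} (hm : k + 1 ≤ m)
    (a c : Fin k → K) (hc : ∀ t, c t ∈ (algebraMap F K).range)
    (h : BrauerGroup.res F K (brauerClass F A) = ∏ t, symb p (a t) (c t)) :
    SymbolLengthLE p F A m := by
  have hp := (Fact.out : p.Prime)
  obtain ⟨β, hβF⟩ : ∃ β : K, β ∉ (algebraMap F K).range := by
    by_contra! hF
    have : Module.finrank F K = 1 :=
      finrank_eq_one_iff_of_nonzero' (1 : K) one_ne_zero |>.mpr fun w =>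
        let ⟨x, hx⟩ := hF w
        ⟨x, by rw [← hx, Algebra.smul_def, mul_one]⟩
    exact hp.one_lt.ne' (hK ▸ this)
  obtain ⟨b, hb⟩ := hpow β
  have hβ0 : β ≠ 0 := fun h0 => hβF (h0 ▸ zero_mem _)
  have hb0 : b ≠ 0 := fun h0 => pow_ne_zero p hβ0 (by rw [← hb, h0, map_zero])
  obtain ⟨B, hB⟩ := exists_basis_pow_of_finrank_eq_prime hK hβF
  choose d hd using hc
  choose ρ hρ using hpow
  refine symbolLengthLE_of_res_eq_prod hb0 hb.symm B hB (ι := Fin k) (by simpa using hm)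
    (fun t => ρ (a t)) d ?_
  simpa only [hρ, symb_pow_left, hd] using h

/-- The case where the second entry of some symbol generates the extension. -/
theorem symbolLengthLE_of_notMem_range (hA : brauerClass F A ^ p = 1)
    (hK : Module.finrank F K = p) (hpow : ∀ z : K, ∃ x : F, algebraMap F K x = z ^ p) {k m : ℕ}
    (hm : k * p ≤ m) (a c : Fin k → K) (hc0 : ∀ t, c t ≠ 0) {s : Fin k}
    (hs : c s ∉ (algebraMap F K).range)
    (h : BrauerGroup.res F K (brauerClass F A) = ∏ t, symb p (a t) (c t)) :
    SymbolLengthLE p F A m := by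
  have hp := (Fact.out : p.Prime)
  obtain ⟨b, hb⟩ := hpow (c s)
  have hb0 : b ≠ 0 := fun h0 => pow_ne_zero p (hc0 s) (by rw [← hb, h0, map_zero])
  obtain ⟨B, hB⟩ := exists_basis_pow_of_finrank_eq_prime hK hs
  choose x d y hxdy using fun t : {t // ¬ t = s} =>
    exists_symb_eq_prod_mul_symb (p := p) hpow (hc0 s) B hB (a t) (hc0 t)
  obtain ⟨α, hα⟩ := hpow (a s)
  have h1 : BrauerGroup.res F K (brauerClass F A) =
      (∏ t : {t // ¬ t = s} × Fin p,
        symb p (algebraMap F K (x t.1 t.2)) (algebraMap F K (d t.1 t.2))) *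
        symb p (algebraMap F K (α + ∑ t, y t)) (c s) := by
    rw [h, ← Fintype.prod_subtype_mul_prod_subtype (· = s), Fintype.prod_prod_type]
    simp only [hxdy, Finset.prod_mul_distrib, map_add, map_sum, symb_add, symb_sum, hα,
      symb_pow_left, Fintype.prod_unique]
    exact mul_left_comm _ _ _
  obtain ⟨g, hg⟩ := exists_eq_add_sum_of_res_eq hA hpow hb.symm hs _ _ _ h1
  obtain ⟨w, hw⟩ := exists_symb_eq_prod_of_eq_add_sum (p := p) hpow hb.symm g
    (Nat.sub_lt hp.pos one_pos)
  rw [hg, hw] at h1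
  refine symbolLengthLE_of_res_eq_prod hb0 hb.symm B hB
    (ι := ({t // ¬ t = s} × Fin p) ⊕ Fin (p - 1)) (le_trans (le_of_eq ?_) hm)
    (Sum.elim (fun t => x t.1 t.2) w) (Sum.elim (fun t => d t.1 t.2) fun t => g (t + 1)) ?_
  · have hk : k - 1 + 1 = k := Nat.sub_add_cancel s.pos
    have hcard : Fintype.card {t // ¬ t = s} = k - 1 := by simp
    rw [Fintype.card_sum, Fintype.card_prod, hcard, Fintype.card_fin, Fintype.card_fin, add_assoc,
      Nat.sub_add_cancel hp.one_le, ← Nat.succ_mul, Nat.succ_eq_add_one, hk]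
  · rw [h1, Fintype.prod_sum_type]
    rfl

end Assembly

/-- If `A` is central simple of exponent `p` over `F` of characteristic `p`,
`K/F` is an inseparable extension of degree `p`, and `λ_p(A_K) ≤ n`, then
`λ_p(A) ≤ n * p`. -/
theorem statement3 (p : ℕ) (hp : p.Prime) (F : Type) [Field F] [CharP F p]
    (A : Type) [Ring A] [Algebra F A] (hA : IsCSA F A) (hexp : HasExponent F A p)
    (K : Type) [Field K] [Algebra F K] (hins : ¬ Algebra.IsSeparable F K)
    (hKd : Module.finrank F K = p)
    (n : ℕ) (hn : 0 < n) (h : SymbolLengthLE p K (K ⊗[F] A) n) :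
    SymbolLengthLE p F A (n * p) := by
  have : Fact p.Prime := ⟨hp⟩
  obtain ⟨_, _, _⟩ := hA
  have : CharP K p := charP_of_injective_algebraMap (algebraMap F K).injective p
  have hpow := pow_mem_range_of_not_isSeparable hKd hins
  obtain ⟨k, hk, a, c, hc0, hac⟩ := brauerClass_eq_prod_of_symbolLengthLE h
  rw [← BrauerGroup.res_brauerClass] at hac
  by_cases hc : ∀ t, c t ∈ (algebraMap F K).range
  · exact symbolLengthLE_of_forall_mem_range hKd hpow (by nlinarith [hp.two_le]) a c hc hac
  · push Not at hc
    obtain ⟨s, hs⟩ := hc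
    exact symbolLengthLE_of_notMem_range hexp.brauerClass_pow_eq_one hKd hpow
      (Nat.mul_le_mul_right p hk) a c hc0 hs hac
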